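/- The algorithm SeqQueue is a non-blocking linearizable implementation of the sequential queue (with its Enq operation wait-free), using base objects (Fetch&Increment and Swap) with consensus number two. -/

import Mathlib

/-- Operations of a queue over items in ℕ. -/
inductive QueueOp
  | enq (x : ℕ)
  | deq
  deriving DecidableEq

/-- Possible outputs: `ok` (= true, for enqueue), an item, or empty (ε). -/
inductive QueueRes
  | ok
  | val (x : ℕ)
  | empty
  deriving DecidableEq

/-- Contents of an entry of `Items`: ⊥ (never written), ⊤ (taken), or an item. -/
inductive Cell
  | bot
  | mark
  | val (x : ℕ)
  deriving DecidableEq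

/-- Local control states of a process executing the algorithm SeqQueue
(the variant of Li's non-blocking queue): `tk'` is the number of taken items
counted in the previous scan, `tk` the count of the current scan, `tl` the read
value of `Tail` minus one, and `r` the entry being scanned. -/
inductive PS
  | idle
  | enq1 (x : ℕ)               -- Enq(x): about to Fetch&Increment `Tail`
  | enq2 (x : ℕ) (tail : ℕ)    -- obtained `tail`: about to write x into `Items[tail]`
  | deqReadTail (tk' : ℕ)      -- beginning of a while iteration: about to read `Tail`
  | deqScan (tk' tk tl r : ℕ)  -- about to read `Items[r]`
  | deqSwap (tk' tk tl r : ℕ)  -- read a non-⊥ value: about to swap ⊤ into `Items[r]`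
  | deqCheck (tk' tk : ℕ)      -- finished a scan: compare taken counts
  | done (res : QueueRes)       -- computed result, about to respond
  deriving DecidableEq

/-- A record of a completed operation. -/
structure LogEntry (n : ℕ) where
  proc : Fin n
  op : QueueOp
  res : QueueRes
  invT : ℕ
  retT : ℕ

/-- A configuration of the system running SeqQueue. -/
structure Config (n : ℕ) where
  tail : ℕ
  items : ℕ → Cell
  proc : Fin n → PS
  pend : Fin n → Option (QueueOp × ℕ)
  log : List (LogEntry n)
  time : ℕ

/-- The initial configuration: `Tail = 1`, all entries of `Items` equal ⊥,
all processes idle. -/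
def initConfig (n : ℕ) : Config n :=
  { tail := 1
    items := fun _ => Cell.bot
    proc := fun _ => PS.idle
    pend := fun _ => none
    log := []
    time := 0 }

/-- One atomic step of process `i` in the algorithm SeqQueue; the base objects are
a Fetch&Increment object `Tail` and Swap objects `Items[r]`, both of consensus
number two. -/
inductive Step {n : ℕ} : Config n → Fin n → Config n → Prop
  | invEnq (c : Config n) (i : Fin n) (x : ℕ)
      (h : c.proc i = PS.idle) (hp : c.pend i = none) :
      Step c i { c with proc := Function.update c.proc i (PS.enq1 x),
                        pend := Function.update c.pend i (some (QueueOp.enq x, c.time)),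
                        time := c.time + 1 }
  | invDeq (c : Config n) (i : Fin n)
      (h : c.proc i = PS.idle) (hp : c.pend i = none) :
      Step c i { c with proc := Function.update c.proc i (PS.deqReadTail 0),
                        pend := Function.update c.pend i (some (QueueOp.deq, c.time)),
                        time := c.time + 1 }
  | enqFAI (c : Config n) (i : Fin n) (x : ℕ)
      (h : c.proc i = PS.enq1 x) :
      Step c i { c with tail := c.tail + 1,
                        proc := Function.update c.proc i (PS.enq2 x c.tail),
                        time := c.time + 1 }
  | enqWrite (c : Config n) (i : Fin n) (x t : ℕ)
      (h : c.proc i = PS.enq2 x t) :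
      Step c i { c with items := fun r => if r = t then Cell.val x else c.items r,
                        proc := Function.update c.proc i (PS.done QueueRes.ok),
                        time := c.time + 1 }
  | deqReadTail_pos (c : Config n) (i : Fin n) (tk' : ℕ)
      (h : c.proc i = PS.deqReadTail tk') (ht : 2 ≤ c.tail) :
      Step c i { c with proc := Function.update c.proc i
                          (PS.deqScan tk' 0 (c.tail - 1) 1),
                        time := c.time + 1 }
  | deqReadTail_zero (c : Config n) (i : Fin n) (tk' : ℕ)
      (h : c.proc i = PS.deqReadTail tk') (ht : c.tail ≤ 1) :
      Step c i { c with proc := Function.update c.proc i (PS.deqCheck tk' 0),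
                        time := c.time + 1 }
  | deqRead_bot_next (c : Config n) (i : Fin n) (tk' tk tl r : ℕ)
      (h : c.proc i = PS.deqScan tk' tk tl r)
      (hx : c.items r = Cell.bot) (hr : r < tl) :
      Step c i { c with proc := Function.update c.proc i (PS.deqScan tk' tk tl (r + 1)),
                        time := c.time + 1 }
  | deqRead_bot_end (c : Config n) (i : Fin n) (tk' tk tl r : ℕ)
      (h : c.proc i = PS.deqScan tk' tk tl r)
      (hx : c.items r = Cell.bot) (hr : tl ≤ r) :
      Step c i { c with proc := Function.update c.proc i (PS.deqCheck tk' tk),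
                        time := c.time + 1 }
  | deqRead_nonbot (c : Config n) (i : Fin n) (tk' tk tl r : ℕ)
      (h : c.proc i = PS.deqScan tk' tk tl r) (hx : c.items r ≠ Cell.bot) :
      Step c i { c with proc := Function.update c.proc i (PS.deqSwap tk' tk tl r),
                        time := c.time + 1 }
  | deqSwap_val (c : Config n) (i : Fin n) (tk' tk tl r x : ℕ)
      (h : c.proc i = PS.deqSwap tk' tk tl r) (hx : c.items r = Cell.val x) :
      Step c i { c with items := fun r' => if r' = r then Cell.mark else c.items r',
                        proc := Function.update c.proc i (PS.done (QueueRes.val x)),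
                        time := c.time + 1 }
  | deqSwap_mark_next (c : Config n) (i : Fin n) (tk' tk tl r : ℕ)
      (h : c.proc i = PS.deqSwap tk' tk tl r) (hx : c.items r = Cell.mark)
      (hr : r < tl) :
      Step c i { c with items := fun r' => if r' = r then Cell.mark else c.items r',
                        proc := Function.update c.proc i
                          (PS.deqScan tk' (tk + 1) tl (r + 1)),
                        time := c.time + 1 }
  | deqSwap_mark_end (c : Config n) (i : Fin n) (tk' tk tl r : ℕ)
      (h : c.proc i = PS.deqSwap tk' tk tl r) (hx : c.items r = Cell.mark)
      (hr : tl ≤ r) :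
      Step c i { c with items := fun r' => if r' = r then Cell.mark else c.items r',
                        proc := Function.update c.proc i (PS.deqCheck tk' (tk + 1)),
                        time := c.time + 1 }
  | deqCheck_eq (c : Config n) (i : Fin n) (tk : ℕ)
      (h : c.proc i = PS.deqCheck tk tk) :
      Step c i { c with proc := Function.update c.proc i (PS.done QueueRes.empty),
                        time := c.time + 1 }
  | deqCheck_ne (c : Config n) (i : Fin n) (tk' tk : ℕ)
      (h : c.proc i = PS.deqCheck tk' tk) (hne : tk ≠ tk') :
      Step c i { c with proc := Function.update c.proc i (PS.deqReadTail tk),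
                        time := c.time + 1 }
  | respond (c : Config n) (i : Fin n) (res : QueueRes) (op : QueueOp) (t0 : ℕ)
      (h : c.proc i = PS.done res) (hp : c.pend i = some (op, t0)) :
      Step c i { c with proc := Function.update c.proc i PS.idle,
                        pend := Function.update c.pend i none,
                        log := c.log ++ [⟨i, op, res, t0, c.time⟩],
                        time := c.time + 1 }

/-- An (infinite) execution of SeqQueue. -/
def Run {n : ℕ} (c : ℕ → Config n) (sched : ℕ → Fin n) : Prop :=
  c 0 = initConfig n ∧ ∀ k, Step (c k) (sched k) (c (k + 1))

/-- A concurrent history: `m` operations, each with its kind, its invocation time,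
and, if completed, its response time and its output (`none` = pending). -/
structure ConcHistory (Op Res : Type) where
  m : ℕ
  op : Fin m → Op
  inv : Fin m → ℕ
  ret : Fin m → Option ℕ
  out : Fin m → Option Res

/-- `op i` precedes `op j`: the response of `i` occurs before the invocation of `j`. -/
def ConcHistory.precedes {Op Res : Type} (h : ConcHistory Op Res) (i j : Fin h.m) : Prop :=
  ∃ t, h.ret i = some t ∧ t < h.inv j

/-- The pending operations of a configuration. -/
def pendingList {n : ℕ} (cfg : Config n) : List (QueueOp × ℕ) :=
  (List.finRange n).filterMap cfg.pend

/-- The history of a configuration: its completed operations (from the log)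
followed by its pending operations. -/
def historyAt {n : ℕ} (cfg : Config n) : ConcHistory QueueOp QueueRes where
  m := cfg.log.length + (pendingList cfg).length
  op := fun k =>
    if hk : (k : ℕ) < cfg.log.length then (cfg.log.get ⟨k, hk⟩).op
    else ((pendingList cfg).getD ((k : ℕ) - cfg.log.length) (QueueOp.deq, 0)).1
  inv := fun k =>
    if hk : (k : ℕ) < cfg.log.length then (cfg.log.get ⟨k, hk⟩).invT
    else ((pendingList cfg).getD ((k : ℕ) - cfg.log.length) (QueueOp.deq, 0)).2
  ret := fun k =>
    if hk : (k : ℕ) < cfg.log.length then some (cfg.log.get ⟨k, hk⟩).retT else none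
  out := fun k =>
    if hk : (k : ℕ) < cfg.log.length then some (cfg.log.get ⟨k, hk⟩).res else none

/-- Transition of the sequential queue. -/
def SeqQueueDelta (q : List ℕ) (p : QueueOp × QueueRes) (q' : List ℕ) : Prop :=
  (∃ x, p = (QueueOp.enq x, QueueRes.ok) ∧ q' = q ++ [x]) ∨
  (∃ x, q = x :: q' ∧ p = (QueueOp.deq, QueueRes.val x)) ∨
  (q = [] ∧ q' = [] ∧ p = (QueueOp.deq, QueueRes.empty))

/-- A sequential execution of the sequential queue. -/
inductive SeqQueueExec : List ℕ → List (QueueOp × QueueRes) → List ℕ → Prop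
  | nil (q : List ℕ) : SeqQueueExec q [] q
  | cons {q q' q'' : List ℕ} {p : QueueOp × QueueRes} {ps : List (QueueOp × QueueRes)} :
      SeqQueueDelta q p q' → SeqQueueExec q' ps q'' → SeqQueueExec q (p :: ps) q''

/-- A linearization of a history `h` w.r.t. the sequential queue. -/
structure Linearization (h : ConcHistory QueueOp QueueRes) where
  seq : List (Fin h.m)
  lout : Fin h.m → QueueRes
  nodup : seq.Nodup
  complete_mem : ∀ i, (h.out i).isSome → i ∈ seq
  out_agree : ∀ i r, h.out i = some r → lout i = r
  order : ∀ k1 k2 : Fin seq.length,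
    h.precedes (seq.get k1) (seq.get k2) → (k1 : ℕ) < (k2 : ℕ)
  valid : ∃ qf, SeqQueueExec [] (seq.map (fun i => (h.op i, lout i))) qf

/-- A history is linearizable w.r.t. the sequential queue. -/
def Linearizable (h : ConcHistory QueueOp QueueRes) : Prop :=
  Nonempty (Linearization h)

/-- The effect of a step that fixes the result of an operation. -/
inductive Ev
  | enq (t x : ℕ)
  | deq (t x : ℕ)
  | emp

def Ev.op : Ev → QueueOp
  | .enq _ x => .enq x
  | .deq _ _ => .deq
  | .emp => .deq

def Ev.res : Ev → QueueRes
  | .enq _ _ => .ok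
  | .deq _ x => .val x
  | .emp => .empty

/-- The event produced by the next step of process `i`, if that step fixes a result. -/
def evt {n : ℕ} (s : Config n) (i : Fin n) : Option Ev :=
  match s.proc i with
  | .enq2 x t => some (.enq t x)
  | .deqSwap _ _ _ r =>
    match s.items r with
    | .val x => some (.deq r x)
    | _ => none
  | .deqCheck tk' tk => if tk' = tk then some .emp else none
  | _ => none

/-- Step `d` fixes the result `res` of the operation `op` invoked at time `a`. -/
def Det {n : ℕ} (c : ℕ → Config n) (sched : ℕ → Fin n) (d : ℕ)
    (op : QueueOp) (res : QueueRes) (a : ℕ) : Prop :=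
  ∃ e, evt (c d) (sched d) = some e ∧ e.op = op ∧ e.res = res ∧
    (c d).pend (sched d) = some (op, a)

def marks {n : ℕ} (s : Config n) (r : ℕ) : Finset ℕ :=
  (Finset.range r).filter fun t => s.items t = Cell.mark

def nonbots {n : ℕ} (s : Config n) (r : ℕ) : Finset ℕ :=
  (Finset.range r).filter fun t => s.items t ≠ Cell.bot

/-- Invariant of a scan at time `k` by a dequeue invoked at time `a` which last read `Tail`
at time `R`. -/
structure Scan {n : ℕ} (c : ℕ → Config n) (sched : ℕ → Fin n)
    (k a R tk' tk tl r : ℕ) : Prop where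
  inv_lt : a < R
  read_lt : R < k
  read_evt : evt (c R) (sched R) = none
  tail_eq : (c R).tail = tl + 1
  r_le : r ≤ tl + 1
  prev_le : tk' ≤ (marks (c R) (tl + 1)).card
  le_count : (nonbots (c R) r).card ≤ tk
  count_le : tk ≤ (marks (c k) r).card
  taken : ∀ t < r, (c R).items t ≠ Cell.bot → (c k).items t = Cell.mark

/-- Invariant of the local state of process `i` at time `k`. -/
def PInv {n : ℕ} (c : ℕ → Config n) (sched : ℕ → Fin n) (k : ℕ) (i : Fin n) : PS → Prop
  | .idle => (c k).pend i = none
  | .enq1 x => ∃ a, (c k).pend i = some (.enq x, a)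
  | .enq2 x t => ∃ a, (c k).pend i = some (.enq x, a) ∧ (c a).tail ≤ t ∧ 1 ≤ t ∧
      t < (c k).tail ∧ (c k).items t = Cell.bot
  | .deqReadTail tk' => ∃ a, (c k).pend i = some (.deq, a) ∧
      tk' ≤ (marks (c k) (c k).tail).card
  | .deqScan tk' tk tl r => ∃ a R, (c k).pend i = some (.deq, a) ∧
      Scan c sched k a R tk' tk tl r ∧ r ≤ tl
  | .deqSwap tk' tk tl r => ∃ a R, (c k).pend i = some (.deq, a) ∧
      Scan c sched k a R tk' tk tl r ∧ r ≤ tl ∧ (c k).items r ≠ Cell.bot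
  | .deqCheck tk' tk => ∃ a R tl, (c k).pend i = some (.deq, a) ∧
      Scan c sched k a R tk' tk tl (tl + 1)
  | .done res => ∃ op a d, (c k).pend i = some (op, a) ∧ d < k ∧ Det c sched d op res a

structure RunInv {n : ℕ} (c : ℕ → Config n) (sched : ℕ → Fin n) (k : ℕ) : Prop where
  tail_pos : 1 ≤ (c k).tail
  items_bot : ∀ t, t = 0 ∨ (c k).tail ≤ t → (c k).items t = Cell.bot
  uniq : ∀ i j x y t, (c k).proc i = .enq2 x t → (c k).proc j = .enq2 y t → i = j
  pinv : ∀ i, PInv c sched k i ((c k).proc i)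

section Invariants

variable {n : ℕ} {c : ℕ → Config n} {sched : ℕ → Fin n}

theorem marks_mono {s s' : Config n} {r r' : ℕ} (hr : r ≤ r')
    (h : ∀ t, s.items t = Cell.mark → s'.items t = Cell.mark) : marks s r ⊆ marks s' r' := by
  intro t ht
  simp only [marks, Finset.mem_filter, Finset.mem_range] at *
  exact ⟨by omega, h _ ht.2⟩

theorem marks_subset_nonbots (s : Config n) (r : ℕ) : marks s r ⊆ nonbots s r := by
  intro t ht
  simp only [marks, nonbots, Finset.mem_filter, Finset.mem_range] at *
  exact ⟨ht.1, by simp [ht.2]⟩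

theorem card_marks_succ_of_mark {s : Config n} {r : ℕ} (h : s.items r = Cell.mark) :
    (marks s (r + 1)).card = (marks s r).card + 1 := by
  simp [marks, Finset.range_add_one, Finset.filter_insert, h]

theorem card_nonbots_succ_le (s : Config n) (r : ℕ) :
    (nonbots s (r + 1)).card ≤ (nonbots s r).card + 1 := by
  simp only [nonbots, Finset.range_add_one, Finset.filter_insert]
  split_ifs
  · exact Finset.card_insert_le _ _
  · omega

theorem card_nonbots_succ_of_bot {s : Config n} {r : ℕ} (h : s.items r = Cell.bot) :
    (nonbots s (r + 1)).card = (nonbots s r).card := by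
  simp [nonbots, Finset.range_add_one, Finset.filter_insert, h]

theorem run_time (h : Run c sched) (k : ℕ) : (c k).time = k := by
  induction k with
  | zero => rw [h.1]; rfl
  | succ k ih =>
    have hs := h.2 k
    generalize c (k + 1) = c' at *
    cases hs <;> simp [ih]

theorem run_tail_mono (h : Run c sched) : Monotone fun k => (c k).tail := by
  refine monotone_nat_of_le_succ fun k => ?_
  have hs := h.2 k
  generalize c (k + 1) = c' at *
  cases hs <;> simp

theorem run_pend (h : Run c sched) (k : ℕ) (i : Fin n) (op : QueueOp) (a : ℕ)
    (hp : (c k).pend i = some (op, a)) : a < k ∧ sched a = i := by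
  induction k generalizing i op a with
  | zero => rw [h.1] at hp; simp [initConfig] at hp
  | succ k ih =>
    have hs := h.2 k
    have ht := run_time h k
    generalize c (k + 1) = c' at *
    have key : (c k).pend i = some (op, a) → a < k + 1 ∧ sched a = i := fun h' =>
      ⟨(ih _ _ _ h').1.trans (Nat.lt_succ_self k), (ih _ _ _ h').2⟩
    cases hs <;> first
      | exact key hp
      | (simp only [Function.update_apply] at hp
         split_ifs at hp with hi
         · simp only [Option.some.injEq, Prod.mk.injEq] at hp
           rw [← hp.2, ht, hi]; exact ⟨Nat.lt_succ_self k, rfl⟩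
         · exact key hp)
      | (simp only [Function.update_apply] at hp
         split_ifs at hp with hi
         exact key hp)

theorem Scan.succ {k a R tk' tk tl r : ℕ} (h : Scan c sched k a R tk' tk tl r)
    (hm : ∀ t, (c k).items t = Cell.mark → (c (k + 1)).items t = Cell.mark) :
    Scan c sched (k + 1) a R tk' tk tl r :=
  { h with
    read_lt := h.read_lt.trans (Nat.lt_succ_self k)
    count_le := h.count_le.trans (Finset.card_le_card (marks_mono le_rfl hm))
    taken := fun t ht hb => hm _ (h.taken t ht hb) }

theorem PInv.succ {k : ℕ} {j : Fin n} {p : PS} (h : PInv c sched k j p)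
    (hpend : (c (k + 1)).pend j = (c k).pend j) (htail : (c k).tail ≤ (c (k + 1)).tail)
    (hm : ∀ t, (c k).items t = Cell.mark → (c (k + 1)).items t = Cell.mark)
    (hn : ∀ t, (c k).items t ≠ Cell.bot → (c (k + 1)).items t ≠ Cell.bot)
    (hb : ∀ x t, p = .enq2 x t → (c k).items t = Cell.bot → (c (k + 1)).items t = Cell.bot) :
    PInv c sched (k + 1) j p := by
  cases p with
  | idle => exact hpend.trans h
  | enq1 x => simpa only [PInv, hpend] using h
  | enq2 x t =>
    obtain ⟨a, h1, h2, h3, h4, h5⟩ := h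
    exact ⟨a, hpend.trans h1, h2, h3, by omega, hb _ _ rfl h5⟩
  | deqReadTail tk' =>
    obtain ⟨a, h1, h2⟩ := h
    exact ⟨a, hpend.trans h1, h2.trans (Finset.card_le_card (marks_mono htail hm))⟩
  | deqScan tk' tk tl r =>
    obtain ⟨a, R, h1, h2, h3⟩ := h
    exact ⟨a, R, hpend.trans h1, h2.succ hm, h3⟩
  | deqSwap tk' tk tl r =>
    obtain ⟨a, R, h1, h2, h3, h4⟩ := h
    exact ⟨a, R, hpend.trans h1, h2.succ hm, h3, hn _ h4⟩
  | deqCheck tk' tk =>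
    obtain ⟨a, R, tl, h1, h2⟩ := h
    exact ⟨a, R, tl, hpend.trans h1, h2.succ hm⟩
  | done res =>
    obtain ⟨op, a, d, h1, h2, h3⟩ := h
    exact ⟨op, a, d, hpend.trans h1, h2.trans (Nat.lt_succ_self k), h3⟩

theorem RunInv.succ {k : ℕ} (h : RunInv c sched k) (p' : PS)
    (hproc : (c (k + 1)).proc = Function.update (c k).proc (sched k) p')
    (hpend : ∀ j, j ≠ sched k → (c (k + 1)).pend j = (c k).pend j)
    (htail : (c k).tail ≤ (c (k + 1)).tail)
    (hm : ∀ t, (c k).items t = Cell.mark → (c (k + 1)).items t = Cell.mark)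
    (hn : ∀ t, (c k).items t ≠ Cell.bot → (c (k + 1)).items t ≠ Cell.bot)
    (hb : ∀ t, (c k).items t = Cell.bot → (c (k + 1)).items t = Cell.bot ∨
      ∃ x, (c k).proc (sched k) = .enq2 x t)
    (hu : ∀ x t, p' = .enq2 x t → t = (c k).tail)
    (hp : PInv c sched (k + 1) (sched k) p') : RunInv c sched (k + 1) where
  tail_pos := h.tail_pos.trans htail
  items_bot := by
    intro t ht
    rcases hb t (h.items_bot t (by omega)) with h1 | ⟨x, hx⟩
    · exact h1
    · have h2 := h.pinv (sched k)
      rw [hx] at h2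
      obtain ⟨a, -, -, h3, h4, -⟩ := h2
      omega
  uniq := by
    have key : ∀ j x y t, p' = .enq2 x t → (c k).proc j = .enq2 y t → False := by
      intro j x y t h1 h2
      have h3 := h.pinv j
      rw [h2] at h3
      obtain ⟨a, -, -, -, h4, -⟩ := h3
      have := hu _ _ h1
      omega
    intro i j x y t hi hj
    rw [hproc, Function.update_apply] at hi hj
    split_ifs at hi hj with h1 h2 h2
    · rw [h1, h2]
    · exact (key _ _ _ _ hi hj).elim
    · exact (key _ _ _ _ hj hi).elim
    · exact h.uniq _ _ _ _ _ hi hj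
  pinv := by
    intro j
    rw [hproc, Function.update_apply]
    split_ifs with hj
    · rw [hj]; exact hp
    · refine (h.pinv j).succ (hpend j hj) htail hm hn ?_
      intro x t hx hbt
      rcases hb t hbt with h1 | ⟨y, hy⟩
      · exact h1
      · exact (hj (h.uniq _ _ _ _ _ hx hy)).elim

theorem Scan.next_bot {k a R tk' tk tl r : ℕ}
    (h : Scan c sched k a R tk' tk tl r) (hr : r ≤ tl)
    (hb : (c R).items r = Cell.bot) : Scan c sched k a R tk' tk tl (r + 1) :=
  { h with
    r_le := by omega
    le_count := by rw [card_nonbots_succ_of_bot hb]; exact h.le_count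
    count_le := h.count_le.trans (Finset.card_le_card (marks_mono (Nat.le_succ r) fun _ => id))
    taken := fun t ht hn => by
      rcases Nat.lt_succ_iff_lt_or_eq.1 ht with h1 | rfl
      · exact h.taken t h1 hn
      · exact (hn hb).elim }

theorem Scan.next_mark {k a R tk' tk tl r : ℕ}
    (h : Scan c sched k a R tk' tk tl r) (hr : r ≤ tl)
    (hb : (c k).items r = Cell.mark) : Scan c sched k a R tk' (tk + 1) tl (r + 1) :=
  { h with
    r_le := by omega
    le_count := (card_nonbots_succ_le _ _).trans (Nat.add_le_add_right h.le_count 1)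
    count_le := by rw [card_marks_succ_of_mark hb]; exact Nat.add_le_add_right h.count_le 1
    taken := fun t ht hn => by
      rcases Nat.lt_succ_iff_lt_or_eq.1 ht with h1 | rfl
      · exact h.taken t h1 hn
      · exact hb }

theorem Scan.start {k a tk' : ℕ} (h : RunInv c sched k) (ha : a < k)
    (hev : evt (c k) (sched k) = none) (htk : tk' ≤ (marks (c k) (c k).tail).card) :
    Scan c sched (k + 1) a k tk' 0 ((c k).tail - 1) 1 := by
  have ht := h.tail_pos
  have h0 := h.items_bot 0 (Or.inl rfl)
  refine ⟨ha, Nat.lt_succ_self k, hev, by omega, by omega, ?_, ?_, Nat.zero_le _, ?_⟩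
  · rwa [Nat.sub_add_cancel ht]
  · simp [nonbots, h0]
  · intro t ht hn
    obtain rfl : t = 0 := by omega
    exact (hn h0).elim

theorem run_items_ne_bot (h : Run c sched) (t : ℕ) {k k' : ℕ} (hk : k ≤ k')
    (hb : (c k).items t ≠ Cell.bot) : (c k').items t ≠ Cell.bot := by
  induction k', hk using Nat.le_induction with
  | base => exact hb
  | succ k' _ ih =>
    have hs := h.2 k'
    generalize c (k' + 1) = c' at *
    cases hs <;> first
      | exact ih
      | (simp only; split_ifs
         · simp
         · exact ih)

theorem run_inv (h : Run c sched) (k : ℕ) : RunInv c sched k := by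
  induction k with
  | zero =>
    have h0 := h.1
    constructor <;> simp [h0, initConfig, PInv]
  | succ k ih =>
    have hs := h.2 k
    have hpi := ih.pinv (sched k)
    have hnb := fun t => run_items_ne_bot h t (Nat.le_succ k)
    have htm : (c k).tail ≤ (c (k + 1)).tail := run_tail_mono h (Nat.le_succ k)
    generalize hc : c (k + 1) = c' at hs
    have hpend : ∀ (i : Fin n) (v : Option (QueueOp × ℕ)),
        ∀ j, j ≠ i → Function.update (c k).pend i v j = (c k).pend j :=
      fun i v j hj => Function.update_of_ne hj _ _
    have hmk : ∀ r, (c k).items r ≠ Cell.bot →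
        c'.items = (fun r' => if r' = r then Cell.mark else (c k).items r') →
        ((∀ t, (c k).items t = Cell.mark → (c (k + 1)).items t = Cell.mark) ∧
          ∀ t, (c k).items t = Cell.bot → (c (k + 1)).items t = Cell.bot ∨
            ∃ x, (c k).proc (sched k) = .enq2 x t) := by
      intro r hr hc'
      rw [hc, hc']
      refine ⟨fun t ht => by simp only; split_ifs <;> simp [ht], fun t ht => Or.inl ?_⟩
      simp only
      rw [if_neg (by rintro rfl; exact hr ht), ht]
    cases hs with
    | invEnq x hi hp =>
      refine ih.succ (.enq1 x) (by rw [hc]) (by rw [hc]; exact hpend _ _) htm (by simp [hc]) hnb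
        (by simp +contextual [hc]) (by simp) ?_
      simp [PInv, hc]
    | invDeq hi hp =>
      refine ih.succ (.deqReadTail 0) (by rw [hc]) (by rw [hc]; exact hpend _ _) htm
        (by simp [hc]) hnb (by simp +contextual [hc]) (by simp) ?_
      simp [PInv, hc]
    | enqFAI x hi =>
      rw [hi] at hpi
      obtain ⟨a, ha⟩ := hpi
      refine ih.succ (.enq2 x (c k).tail) (by rw [hc]) (by simp [hc]) htm
        (by simp [hc]) hnb (by simp +contextual [hc])
        (by rintro y t ht; simp only [PS.enq2.injEq] at ht; exact ht.2.symm) ?_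
      refine ⟨a, by rw [hc]; exact ha, ?_, ih.tail_pos, by simp [hc], ?_⟩
      · exact run_tail_mono h (run_pend h _ _ _ _ ha).1.le
      · simpa [hc] using ih.items_bot _ (Or.inr le_rfl)
    | enqWrite x t hi =>
      rw [hi] at hpi
      obtain ⟨a, ha, h1, h2, h3, h4⟩ := hpi
      refine ih.succ (.done .ok) (by rw [hc]) (by simp [hc]) htm ?_ hnb ?_ (by simp) ?_
      · intro t' ht'
        have : t' ≠ t := by rintro rfl; simp [h4] at ht'
        simp [hc, this, ht']
      · intro t' ht'
        by_cases htt : t' = t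
        · subst htt; exact Or.inr ⟨x, hi⟩
        · left; simp [hc, htt, ht']
      · exact ⟨.enq x, a, k, by rw [hc]; exact ha, Nat.lt_succ_self k,
          .enq t x, by simp [evt, hi], rfl, rfl, ha⟩
    | deqReadTail_pos tk' hi ht =>
      rw [hi] at hpi
      obtain ⟨a, ha, h1⟩ := hpi
      refine ih.succ (.deqScan tk' 0 ((c k).tail - 1) 1) (by rw [hc]) (by simp [hc]) htm
        (by simp [hc]) hnb (by simp +contextual [hc]) (by simp) ?_
      exact ⟨a, k, by rw [hc]; exact ha,
        Scan.start ih (run_pend h _ _ _ _ ha).1 (by simp [evt, hi]) h1, by omega⟩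
    | deqReadTail_zero tk' hi ht =>
      rw [hi] at hpi
      obtain ⟨a, ha, h1⟩ := hpi
      refine ih.succ (.deqCheck tk' 0) (by rw [hc]) (by simp [hc]) htm
        (by simp [hc]) hnb (by simp +contextual [hc]) (by simp) ?_
      have h2 := Scan.start ih (run_pend h _ _ _ _ ha).1 (by simp [evt, hi]) h1
      rw [show (c k).tail - 1 = 0 by omega] at h2
      exact ⟨a, k, 0, by rw [hc]; exact ha, h2⟩
    | deqRead_bot_next tk' tk tl r hi hx hr =>
      rw [hi] at hpi
      obtain ⟨a, R, ha, h1, h2⟩ := hpi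
      refine ih.succ (.deqScan tk' tk tl (r + 1)) (by rw [hc]) (by simp [hc]) htm
        (by simp [hc]) hnb (by simp +contextual [hc]) (by simp) ?_
      exact ⟨a, R, by rw [hc]; exact ha,
        (h1.next_bot h2 (by by_contra hb; exact run_items_ne_bot h r h1.read_lt.le hb hx)).succ
          (by simp [hc]), hr⟩
    | deqRead_bot_end tk' tk tl r hi hx hr =>
      rw [hi] at hpi
      obtain ⟨a, R, ha, h1, h2⟩ := hpi
      refine ih.succ (.deqCheck tk' tk) (by rw [hc]) (by simp [hc]) htm
        (by simp [hc]) hnb (by simp +contextual [hc]) (by simp) ?_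
      obtain rfl := le_antisymm h2 hr
      exact ⟨a, R, r, by rw [hc]; exact ha,
        (h1.next_bot h2 (by by_contra hb; exact run_items_ne_bot h r h1.read_lt.le hb hx)).succ
          (by simp [hc])⟩
    | deqRead_nonbot tk' tk tl r hi hx =>
      rw [hi] at hpi
      obtain ⟨a, R, ha, h1, h2⟩ := hpi
      refine ih.succ (.deqSwap tk' tk tl r) (by rw [hc]) (by simp [hc]) htm
        (by simp [hc]) hnb (by simp +contextual [hc]) (by simp) ?_
      exact ⟨a, R, by rw [hc]; exact ha, h1.succ (by simp [hc]), h2, hnb _ hx⟩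
    | deqSwap_val tk' tk tl r x hi hx =>
      rw [hi] at hpi
      obtain ⟨a, R, ha, h1, h2, h3⟩ := hpi
      obtain ⟨hm, hb⟩ := hmk r h3 rfl
      refine ih.succ (.done (.val x)) (by rw [hc]) (by simp [hc]) htm hm hnb hb (by simp) ?_
      exact ⟨.deq, a, k, by rw [hc]; exact ha, Nat.lt_succ_self k,
        .deq r x, by simp [evt, hi, hx], rfl, rfl, ha⟩
    | deqSwap_mark_next tk' tk tl r hi hx hr =>
      rw [hi] at hpi
      obtain ⟨a, R, ha, h1, h2, h3⟩ := hpi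
      obtain ⟨hm, hb⟩ := hmk r h3 rfl
      refine ih.succ (.deqScan tk' (tk + 1) tl (r + 1)) (by rw [hc]) (by simp [hc]) htm hm hnb hb
        (by simp) ?_
      exact ⟨a, R, by rw [hc]; exact ha, (h1.next_mark h2 hx).succ hm, hr⟩
    | deqSwap_mark_end tk' tk tl r hi hx hr =>
      rw [hi] at hpi
      obtain ⟨a, R, ha, h1, h2, h3⟩ := hpi
      obtain ⟨hm, hb⟩ := hmk r h3 rfl
      refine ih.succ (.deqCheck tk' (tk + 1)) (by rw [hc]) (by simp [hc]) htm hm hnb hb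
        (by simp) ?_
      obtain rfl := le_antisymm h2 hr
      exact ⟨a, R, r, by rw [hc]; exact ha, (h1.next_mark h2 hx).succ hm⟩
    | deqCheck_eq tk hi =>
      rw [hi] at hpi
      obtain ⟨a, R, tl, ha, h1⟩ := hpi
      refine ih.succ (.done .empty) (by rw [hc]) (by simp [hc]) htm
        (by simp [hc]) hnb (by simp +contextual [hc]) (by simp) ?_
      exact ⟨.deq, a, k, by rw [hc]; exact ha, Nat.lt_succ_self k,
        .emp, by simp [evt, hi], rfl, rfl, ha⟩
    | deqCheck_ne tk' tk hi hne =>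
      rw [hi] at hpi
      obtain ⟨a, R, tl, ha, h1⟩ := hpi
      refine ih.succ (.deqReadTail tk) (by rw [hc]) (by simp [hc]) htm
        (by simp [hc]) hnb (by simp +contextual [hc]) (by simp) ?_
      refine ⟨a, by rw [hc]; exact ha, h1.count_le.trans (Finset.card_le_card
        (marks_mono ?_ (by simp [hc])))⟩
      rw [← h1.tail_eq]
      exact run_tail_mono h (h1.read_lt.le.trans (Nat.le_succ k))
    | respond res op t0 hi hp =>
      refine ih.succ .idle (by rw [hc]) (by rw [hc]; exact hpend _ _) htm
        (by simp [hc]) hnb (by simp +contextual [hc]) (by simp) ?_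
      simp [PInv, hc]

theorem evt_enq {s : Config n} {i : Fin n} {t x : ℕ} :
    evt s i = some (.enq t x) ↔ s.proc i = .enq2 x t := by
  unfold evt
  repeat' split
  all_goals simp_all
  exact and_comm

theorem evt_deq {s : Config n} {i : Fin n} {t x : ℕ} :
    evt s i = some (.deq t x) ↔
      s.items t = .val x ∧ ∃ tk' tk tl, s.proc i = .deqSwap tk' tk tl t := by
  unfold evt
  repeat' split
  all_goals simp_all
  all_goals grind

theorem evt_emp {s : Config n} {i : Fin n} :
    evt s i = some .emp ↔ ∃ tk, s.proc i = .deqCheck tk tk := by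
  unfold evt
  repeat' split
  all_goals simp_all
  exact Ne.symm ‹_›

theorem step_of_evt {s s' : Config n} {i : Fin n} {e : Ev} (h : Step s i s')
    (he : evt s i = some e) : s'.proc i = .done e.res ∧ s'.pend = s.pend ∧
      (∀ t x, e = .enq t x → s'.items t = .val x) ∧
      (∀ t x, e = .deq t x → s'.items t = .mark) := by
  cases e with
  | enq t x => rw [evt_enq] at he; cases h <;> simp_all [Ev.res]
  | deq t x =>
    rw [evt_deq] at he
    obtain ⟨h1, tk', tk, tl, h2⟩ := he
    cases h <;> simp_all [Ev.res]
  | emp =>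
    rw [evt_emp] at he
    obtain ⟨tk, h2⟩ := he
    cases h <;> simp_all [Ev.res]

theorem run_items_step (h : Run c sched) (k t : ℕ) :
    (c (k + 1)).items t = (c k).items t ∨
    (∃ x, evt (c k) (sched k) = some (.enq t x) ∧ (c k).items t = .bot ∧
      (c (k + 1)).items t = .val x) ∨
    (∃ x, evt (c k) (sched k) = some (.deq t x) ∧ (c k).items t = .val x ∧
      (c (k + 1)).items t = .mark) := by
  have hs := h.2 k
  have hpi := (run_inv h k).pinv (sched k)
  generalize c (k + 1) = c' at *
  cases hs with
  | enqWrite x t' hi =>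
    rw [hi] at hpi
    obtain ⟨a, -, -, -, -, h4⟩ := hpi
    by_cases ht : t = t'
    · subst ht
      exact Or.inr (Or.inl ⟨x, evt_enq.2 hi, h4, by simp⟩)
    · left; simp [ht]
  | deqSwap_val tk' tk tl r x hi hx =>
    by_cases ht : t = r
    · subst ht
      exact Or.inr (Or.inr ⟨x, evt_deq.2 ⟨hx, tk', tk, tl, hi⟩, hx, by simp⟩)
    · left; simp [ht]
  | deqSwap_mark_next tk' tk tl r hi hx hr =>
    left; by_cases ht : t = r <;> simp [ht, hx]
  | deqSwap_mark_end tk' tk tl r hi hx hr =>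
    left; by_cases ht : t = r <;> simp [ht, hx]
  | _ => exact Or.inl rfl

theorem run_items_mark (h : Run c sched) (t : ℕ) {k k' : ℕ} (hk : k ≤ k')
    (hb : (c k).items t = Cell.mark) : (c k').items t = Cell.mark := by
  induction k', hk using Nat.le_induction with
  | base => exact hb
  | succ k' _ ih =>
    rcases run_items_step h k' t with h1 | ⟨x, -, h1, -⟩ | ⟨x, -, h1, -⟩ <;> simp_all

theorem exists_enq_of_val (h : Run c sched) {k t x : ℕ} (hv : (c k).items t = .val x) :
    ∃ d < k, evt (c d) (sched d) = some (.enq t x) := by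
  induction k with
  | zero => rw [h.1] at hv; simp [initConfig] at hv
  | succ k ih =>
    rcases run_items_step h k t with h1 | ⟨y, h1, -, h2⟩ | ⟨y, -, -, h2⟩
    · obtain ⟨d, hd, he⟩ := ih (h1 ▸ hv)
      exact ⟨d, hd.trans (Nat.lt_succ_self k), he⟩
    · rw [h2, Cell.val.injEq] at hv
      exact ⟨k, Nat.lt_succ_self k, hv ▸ h1⟩
    · simp [h2] at hv

theorem exists_deq_of_mark (h : Run c sched) {k t : ℕ} (hv : (c k).items t = .mark) :
    ∃ d < k, ∃ x, evt (c d) (sched d) = some (.deq t x) := by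
  induction k with
  | zero => rw [h.1] at hv; simp [initConfig] at hv
  | succ k ih =>
    rcases run_items_step h k t with h1 | ⟨y, -, -, h2⟩ | ⟨y, h1, -, h2⟩
    · obtain ⟨d, hd, he⟩ := ih (h1 ▸ hv)
      exact ⟨d, hd.trans (Nat.lt_succ_self k), he⟩
    · simp [h2] at hv
    · exact ⟨k, Nat.lt_succ_self k, y, h1⟩

theorem items_bot_of_enq (h : Run c sched) {k t x : ℕ}
    (he : evt (c k) (sched k) = some (.enq t x)) : (c k).items t = .bot := by
  have hpi := (run_inv h k).pinv (sched k)
  rw [evt_enq.1 he] at hpi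
  obtain ⟨a, -, -, -, -, h4⟩ := hpi
  exact h4

theorem items_ne_bot_of_enq_lt (h : Run c sched) {k k' t x : ℕ} (hk : k < k')
    (he : evt (c k) (sched k) = some (.enq t x)) : (c k').items t ≠ .bot := by
  refine run_items_ne_bot h t hk ?_
  rw [(step_of_evt (h.2 k) he).2.2.1 t x rfl]
  simp

theorem items_mark_of_deq_lt (h : Run c sched) {k k' t x : ℕ} (hk : k < k')
    (he : evt (c k) (sched k) = some (.deq t x)) : (c k').items t = .mark :=
  run_items_mark h t hk ((step_of_evt (h.2 k) he).2.2.2 t x rfl)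

theorem enq_unique (h : Run c sched) {k k' t x x' : ℕ}
    (he : evt (c k) (sched k) = some (.enq t x))
    (he' : evt (c k') (sched k') = some (.enq t x')) : k = k' := by
  rcases lt_trichotomy k k' with hk | hk | hk
  · exact (items_ne_bot_of_enq_lt h hk he (items_bot_of_enq h he')).elim
  · exact hk
  · exact (items_ne_bot_of_enq_lt h hk he' (items_bot_of_enq h he)).elim

theorem deq_unique (h : Run c sched) {k k' t x x' : ℕ}
    (he : evt (c k) (sched k) = some (.deq t x))
    (he' : evt (c k') (sched k') = some (.deq t x')) : k = k' := by
  rcases lt_trichotomy k k' with hk | hk | hk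
  · have := items_mark_of_deq_lt h hk he
    simp [(evt_deq.1 he').1] at this
  · exact hk
  · have := items_mark_of_deq_lt h hk he'
    simp [(evt_deq.1 he).1] at this

theorem exists_enq_of_deq (h : Run c sched) {k t x : ℕ}
    (he : evt (c k) (sched k) = some (.deq t x)) :
    ∃ d < k, evt (c d) (sched d) = some (.enq t x) :=
  exists_enq_of_val h (evt_deq.1 he).1

theorem exists_det_of_evt (h : Run c sched) {k : ℕ} {e : Ev}
    (he : evt (c k) (sched k) = some e) :
    ∃ a < k, (c k).pend (sched k) = some (e.op, a) := by
  have hpi := (run_inv h k).pinv (sched k)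
  have : ∃ a, (c k).pend (sched k) = some (e.op, a) := by
    cases e with
    | enq t x =>
      rw [evt_enq.1 he] at hpi
      obtain ⟨a, h1, -⟩ := hpi
      exact ⟨a, h1⟩
    | deq t x =>
      obtain ⟨-, tk', tk, tl, hp⟩ := evt_deq.1 he
      rw [hp] at hpi
      obtain ⟨a, R, h1, -⟩ := hpi
      exact ⟨a, h1⟩
    | emp =>
      obtain ⟨tk, hp⟩ := evt_emp.1 he
      rw [hp] at hpi
      obtain ⟨a, R, tl, h1, -⟩ := hpi
      exact ⟨a, h1⟩
  obtain ⟨a, ha⟩ := this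
  exact ⟨a, (run_pend h _ _ _ _ ha).1, ha⟩

theorem tail_le_of_enq (h : Run c sched) {k t x a : ℕ} {op : QueueOp}
    (he : evt (c k) (sched k) = some (.enq t x))
    (ha : (c k).pend (sched k) = some (op, a)) : (c a).tail ≤ t := by
  have hpi := (run_inv h k).pinv (sched k)
  rw [evt_enq.1 he] at hpi
  obtain ⟨b, h1, h2, -⟩ := hpi
  rw [h1, Option.some.injEq, Prod.mk.injEq] at ha
  exact ha.2 ▸ h2

/-- A position written before time `a` is below the value of `Tail` at time `a`. -/
theorem lt_tail_of_enq_lt (h : Run c sched) {k' t' x' a : ℕ}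
    (he' : evt (c k') (sched k') = some (.enq t' x')) (hk : k' < a) : t' < (c a).tail := by
  by_contra hlt
  exact items_ne_bot_of_enq_lt h hk he' ((run_inv h a).items_bot _ (Or.inr (by omega)))

/-- Items are taken in an order compatible with the precedence of their enqueues. -/
theorem exists_deq_lt_of_lt_inv (h : Run c sched) {k k' d t t' x x' y a : ℕ} {op : QueueOp}
    (he : evt (c k) (sched k) = some (.enq t x))
    (ha : (c k).pend (sched k) = some (op, a))
    (he' : evt (c k') (sched k') = some (.enq t' x')) (hk : k' < a)
    (hd : evt (c d) (sched d) = some (.deq t y)) :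
    ∃ d' < d, ∃ z, evt (c d') (sched d') = some (.deq t' z) := by
  have h1 := tail_le_of_enq h he ha
  have h2 := lt_tail_of_enq_lt h he' hk
  obtain ⟨-, tk', tk, tl, hp⟩ := evt_deq.1 hd
  have hpi := (run_inv h d).pinv (sched d)
  rw [hp] at hpi
  obtain ⟨b, R, -, hsc, hr, -⟩ := hpi
  have haR : a ≤ R := by
    by_contra hlt
    have : (c R).tail ≤ (c a).tail := run_tail_mono h (by omega)
    have := hsc.tail_eq
    omega
  exact exists_deq_of_mark h
    (hsc.taken t' (by omega) (items_ne_bot_of_enq_lt h (by omega) he'))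

/-- For a dequeue returning empty, every item written before its last read of `Tail` was
taken before that read. -/
theorem exists_read_of_emp (h : Run c sched) {k a : ℕ} {op : QueueOp}
    (he : evt (c k) (sched k) = some .emp)
    (ha : (c k).pend (sched k) = some (op, a)) :
    ∃ R, a < R ∧ R < k ∧ evt (c R) (sched R) = none ∧
      ∀ k' < R, ∀ t x, evt (c k') (sched k') = some (.enq t x) →
        ∃ d < R, ∃ y, evt (c d) (sched d) = some (.deq t y) := by
  obtain ⟨tk, hp⟩ := evt_emp.1 he
  have hpi := (run_inv h k).pinv (sched k)
  rw [hp] at hpi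
  obtain ⟨b, R, tl, h1, hsc⟩ := hpi
  rw [h1, Option.some.injEq, Prod.mk.injEq] at ha
  refine ⟨R, ha.2 ▸ hsc.inv_lt, hsc.read_lt, hsc.read_evt, fun k' hk' t x he' => ?_⟩
  have heq : marks (c R) (tl + 1) = nonbots (c R) (tl + 1) :=
    Finset.eq_of_subset_of_card_le (marks_subset_nonbots _ _)
      (hsc.le_count.trans hsc.prev_le)
  have hne := items_ne_bot_of_enq_lt h hk' he'
  have hlt : t < tl + 1 := by
    by_contra hge
    exact hne ((run_inv h R).items_bot _ (Or.inr (by rw [hsc.tail_eq]; omega)))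
  have hmem : t ∈ nonbots (c R) (tl + 1) := by simp [nonbots, hlt, hne]
  rw [← heq] at hmem
  simp only [marks, Finset.mem_filter] at hmem
  exact exists_deq_of_mark h hmem.2

theorem deqCheck_le (h : Run c sched) {k tk' tk : ℕ} {i : Fin n}
    (hp : (c k).proc i = .deqCheck tk' tk) : tk' ≤ tk ∧ tk ≤ (c k).tail := by
  have hpi := (run_inv h k).pinv i
  rw [hp] at hpi
  obtain ⟨b, R, tl, -, hsc⟩ := hpi
  refine ⟨hsc.prev_le.trans ((Finset.card_le_card (marks_subset_nonbots _ _)).trans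
    hsc.le_count), hsc.count_le.trans ((Finset.card_filter_le _ _).trans ?_)⟩
  rw [Finset.card_range, ← hsc.tail_eq]
  exact run_tail_mono h hsc.read_lt.le

/-- Between two steps of process `i` its local state and pending operation do not change. -/
theorem exists_next_step (h : Run c sched) {i : Fin n} (hi : ∀ k, ∃ k' ≥ k, sched k' = i)
    (k : ℕ) : ∃ k' ≥ k, sched k' = i ∧ (c k').proc i = (c k).proc i ∧
      (c k').pend i = (c k).pend i := by
  classical
  obtain ⟨hk, hs⟩ := Nat.find_spec (hi k)
  refine ⟨_, hk, hs, ?_⟩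
  have : ∀ j, k ≤ j → j ≤ Nat.find (hi k) →
      (c j).proc i = (c k).proc i ∧ (c j).pend i = (c k).pend i := by
    intro j hj
    induction j, hj using Nat.le_induction with
    | base => simp
    | succ j hj ih =>
      intro hle
      obtain ⟨h1, h2⟩ := ih (by omega)
      have hne : i ≠ sched j := fun he =>
        Nat.find_min (hi k) (show j < Nat.find (hi k) by omega) ⟨hj, he.symm⟩
      have hst := h.2 j
      rw [← h1, ← h2]
      generalize c (j + 1) = c' at *
      cases hst <;> simp [Function.update_of_ne hne]
  exact this _ hk le_rfl

theorem done_waitFree (h : Run c sched) {i : Fin n} (hi : ∀ k, ∃ k' ≥ k, sched k' = i)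
    {k : ℕ} {res : QueueRes} (hp : (c k).proc i = .done res) :
    ∃ k' > k, (c k').pend i = none := by
  obtain ⟨k', hk, rfl, h1, -⟩ := exists_next_step h hi k
  refine ⟨k' + 1, by omega, ?_⟩
  rw [hp] at h1
  have hst := h.2 k'
  generalize c (k' + 1) = c' at *
  cases hst <;> simp_all

theorem enq2_waitFree (h : Run c sched) {i : Fin n} (hi : ∀ k, ∃ k' ≥ k, sched k' = i)
    {k x t : ℕ} (hp : (c k).proc i = .enq2 x t) :
    ∃ k' > k, (c k').pend i = none := by
  obtain ⟨k', hk, rfl, h1, -⟩ := exists_next_step h hi k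
  rw [hp] at h1
  obtain ⟨k'', hk', h2⟩ := done_waitFree h hi (step_of_evt (h.2 k') (evt_enq.2 h1)).1
  exact ⟨k'', by omega, h2⟩

theorem enq_waitFree (h : Run c sched) {i : Fin n} (hi : ∀ k, ∃ k' ≥ k, sched k' = i)
    {k x t : ℕ} (hp : (c k).pend i = some (.enq x, t)) :
    ∃ k' > k, (c k').pend i = none := by
  have hpi := (run_inv h k).pinv i
  cases hpr : (c k).proc i with
  | enq1 y =>
    obtain ⟨k', hk, rfl, h1, -⟩ := exists_next_step h hi k
    rw [hpr] at h1
    have : ∃ t, (c (k' + 1)).proc (sched k') = .enq2 y t := by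
      have hst := h.2 k'
      generalize c (k' + 1) = c' at *
      cases hst <;> simp_all
    obtain ⟨t, ht⟩ := this
    obtain ⟨k'', hk', h2⟩ := enq2_waitFree h hi ht
    exact ⟨k'', by omega, h2⟩
  | enq2 y t => exact enq2_waitFree h hi hpr
  | done res => exact done_waitFree h hi hpr
  | _ => rw [hpr] at hpi; simp [PInv, hp] at hpi

end Invariants

section NonBlocking

variable {n : ℕ} {c : ℕ → Config n} {sched : ℕ → Fin n}

/-- `1` if the process may still increment `Tail` before its next response. -/
def tailWeight : PS → ℕ
  | .enq2 _ _ => 0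
  | .done _ => 0
  | _ => 1

/-- Bound on the number of steps before the next response, when `Tail ≤ T`. -/
def stepWeight (T : ℕ) : PS → ℕ
  | .idle => (T + 3) * (2 * T + 10)
  | .enq1 _ => 2
  | .enq2 _ _ => 1
  | .deqReadTail tk' => (T + 1 - tk') * (2 * T + 10) + (2 * T + 10)
  | .deqScan tk' _ tl r => (T + 1 - tk') * (2 * T + 10) + 2 * (tl + 1 - r) + 3
  | .deqSwap tk' _ tl r => (T + 1 - tk') * (2 * T + 10) + 2 * (tl + 1 - r) + 2
  | .deqCheck tk' _ => (T + 1 - tk') * (2 * T + 10) + 1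
  | .done _ => 0

def total (f : PS → ℕ) (p : Fin n → PS) : ℕ := ∑ j, f (p j)

theorem total_update_add (f : PS → ℕ) (p : Fin n → PS) (i : Fin n) (q : PS) :
    total f (Function.update p i q) + f (p i) = total f p + f q := by
  unfold total
  rw [Fintype.sum_eq_add_sum_compl i, Fintype.sum_eq_add_sum_compl i (fun j => f (p j)),
    Function.update_self]
  have : ∑ j ∈ ({i} : Finset (Fin n))ᶜ, f (Function.update p i q j)
      = ∑ j ∈ ({i} : Finset (Fin n))ᶜ, f (p j) := by
    refine Finset.sum_congr rfl fun j hj => ?_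
    rw [Function.update_of_ne (by simpa using hj)]
  omega

theorem tail_add_le (h : Run c sched) (k : ℕ) :
    (c k).tail + total tailWeight (c k).proc ≤ (c k).log.length + n + 1 := by
  induction k with
  | zero => rw [h.1]; simp [initConfig, total, tailWeight]; omega
  | succ k ih =>
    have hs := h.2 k
    have hsum := total_update_add tailWeight (c k).proc (sched k)
    generalize c (k + 1) = c' at *
    cases hs with
    | invEnq x hi hp => have := hsum (.enq1 x); simp only [hi, tailWeight] at this ⊢; omega
    | invDeq hi hp => have := hsum (.deqReadTail 0); simp only [hi, tailWeight] at this ⊢; omega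
    | enqFAI x hi =>
      have := hsum (.enq2 x (c k).tail); simp only [hi, tailWeight] at this ⊢; omega
    | enqWrite x t hi => have := hsum (.done .ok); simp only [hi, tailWeight] at this ⊢; omega
    | deqReadTail_pos tk' hi ht =>
      have := hsum (.deqScan tk' 0 ((c k).tail - 1) 1)
      simp only [hi, tailWeight] at this ⊢; omega
    | deqReadTail_zero tk' hi ht =>
      have := hsum (.deqCheck tk' 0); simp only [hi, tailWeight] at this ⊢; omega
    | deqRead_bot_next tk' tk tl r hi hx hr =>
      have := hsum (.deqScan tk' tk tl (r + 1)); simp only [hi, tailWeight] at this ⊢; omega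
    | deqRead_bot_end tk' tk tl r hi hx hr =>
      have := hsum (.deqCheck tk' tk); simp only [hi, tailWeight] at this ⊢; omega
    | deqRead_nonbot tk' tk tl r hi hx =>
      have := hsum (.deqSwap tk' tk tl r); simp only [hi, tailWeight] at this ⊢; omega
    | deqSwap_val tk' tk tl r x hi hx =>
      have := hsum (.done (.val x)); simp only [hi, tailWeight] at this ⊢; omega
    | deqSwap_mark_next tk' tk tl r hi hx hr =>
      have := hsum (.deqScan tk' (tk + 1) tl (r + 1))
      simp only [hi, tailWeight] at this ⊢; omega
    | deqSwap_mark_end tk' tk tl r hi hx hr =>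
      have := hsum (.deqCheck tk' (tk + 1)); simp only [hi, tailWeight] at this ⊢; omega
    | deqCheck_eq tk hi => have := hsum (.done .empty); simp only [hi, tailWeight] at this ⊢; omega
    | deqCheck_ne tk' tk hi hne =>
      have := hsum (.deqReadTail tk); simp only [hi, tailWeight] at this ⊢; omega
    | respond res op t0 hi hp =>
      have := hsum .idle
      simp only [hi, tailWeight, List.length_append, List.length_singleton] at this ⊢; omega

theorem stepWeight_lt (h : Run c sched) {T k : ℕ} (hT : (c k).tail ≤ T) :
    (total (stepWeight T) (c (k + 1)).proc < total (stepWeight T) (c k).proc ∧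
      (c (k + 1)).log.length = (c k).log.length) ∨
    (total (stepWeight T) (c (k + 1)).proc =
      total (stepWeight T) (c k).proc + (T + 3) * (2 * T + 10) ∧
      (c (k + 1)).log.length = (c k).log.length + 1) := by
  have hs := h.2 k
  have hsum := total_update_add (stepWeight T) (c k).proc (sched k)
  have hck := fun tk' tk => deqCheck_le h (k := k) (tk' := tk') (tk := tk) (i := sched k)
  have h3 : (T + 3) * (2 * T + 10) =
      (T + 1 - 0) * (2 * T + 10) + (2 * T + 10) + (2 * T + 10) := by
    rw [Nat.sub_zero]; ring
  generalize c (k + 1) = c' at *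
  cases hs with
  | invEnq x hi hp =>
    left; have := hsum (.enq1 x); simp only [hi, stepWeight, and_true] at this ⊢; omega
  | invDeq hi hp =>
    left; have := hsum (.deqReadTail 0); simp only [hi, stepWeight, and_true] at this ⊢; omega
  | enqFAI x hi =>
    left; have := hsum (.enq2 x (c k).tail); simp only [hi, stepWeight, and_true] at this ⊢; omega
  | enqWrite x t hi =>
    left; have := hsum (.done .ok); simp only [hi, stepWeight, and_true] at this ⊢; omega
  | deqReadTail_pos tk' hi ht =>
    left
    have := hsum (.deqScan tk' 0 ((c k).tail - 1) 1)
    simp only [hi, stepWeight, and_true] at this ⊢; omega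
  | deqReadTail_zero tk' hi ht =>
    left; have := hsum (.deqCheck tk' 0); simp only [hi, stepWeight, and_true] at this ⊢; omega
  | deqRead_bot_next tk' tk tl r hi hx hr =>
    left
    have := hsum (.deqScan tk' tk tl (r + 1)); simp only [hi, stepWeight, and_true] at this ⊢; omega
  | deqRead_bot_end tk' tk tl r hi hx hr =>
    left; have := hsum (.deqCheck tk' tk); simp only [hi, stepWeight, and_true] at this ⊢; omega
  | deqRead_nonbot tk' tk tl r hi hx =>
    left; have := hsum (.deqSwap tk' tk tl r); simp only [hi, stepWeight, and_true] at this ⊢; omega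
  | deqSwap_val tk' tk tl r x hi hx =>
    left; have := hsum (.done (.val x)); simp only [hi, stepWeight, and_true] at this ⊢; omega
  | deqSwap_mark_next tk' tk tl r hi hx hr =>
    left
    have := hsum (.deqScan tk' (tk + 1) tl (r + 1))
    simp only [hi, stepWeight, and_true] at this ⊢; omega
  | deqSwap_mark_end tk' tk tl r hi hx hr =>
    left; have := hsum (.deqCheck tk' (tk + 1)); simp only [hi, stepWeight, and_true] at this ⊢; omega
  | deqCheck_eq tk hi =>
    left; have := hsum (.done .empty); simp only [hi, stepWeight, and_true] at this ⊢; omega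
  | deqCheck_ne tk' tk hi hne =>
    left
    have := hsum (.deqReadTail tk)
    obtain ⟨h1, h2⟩ := hck _ _ hi
    have h4 : (T + 1 - tk) * (2 * T + 10) + (2 * T + 10) ≤ (T + 1 - tk') * (2 * T + 10) := by
      rw [← Nat.succ_mul]
      exact Nat.mul_le_mul_right _ (by omega)
    simp only [hi, stepWeight, and_true] at this ⊢; omega
  | respond res op t0 hi hp =>
    right
    have := hsum .idle
    simp only [hi, stepWeight, List.length_append, List.length_singleton, and_true] at this ⊢; omega

theorem run_nonBlocking (h : Run c sched) (m : ℕ) : ∃ k, m ≤ (c k).log.length := by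
  by_contra! hlt
  set T := m + n + 1 with hT
  set C := (T + 3) * (2 * T + 10) with hC
  have htail : ∀ k, (c k).tail ≤ T := fun k => by
    have h1 := tail_add_le h k
    have h2 := hlt k
    omega
  have key : ∀ k, total (stepWeight T) (c k).proc + (m - (c k).log.length) * (C + 1) + k ≤
      total (stepWeight T) (c 0).proc + (m - (c 0).log.length) * (C + 1) := by
    intro k
    induction k with
    | zero => simp
    | succ k ih =>
      rcases stepWeight_lt h (htail k) with ⟨h1, h2⟩ | ⟨h1, h2⟩
      · rw [h2]; omega
      · have h3 := hlt (k + 1)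
        have h4 : m - (c k).log.length = (m - (c (k + 1)).log.length) + 1 := by omega
        rw [h4, Nat.succ_mul] at ih
        omega
  have := key (total (stepWeight T) (c 0).proc + (m - (c 0).log.length) * (C + 1) + 1)
  omega

end NonBlocking

section Sequential

def Ev.enqPair : Ev → Option (ℕ × ℕ)
  | .enq t x => some (t, x)
  | _ => none

def Ev.deqPair : Ev → Option (ℕ × ℕ)
  | .deq t x => some (t, x)
  | _ => none

theorem Ev.enqPair_eq_some {e : Ev} {q : ℕ × ℕ} : e.enqPair = some q ↔ e = .enq q.1 q.2 := by
  cases e <;> simp [Ev.enqPair, Prod.ext_iff]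

theorem Ev.deqPair_eq_some {e : Ev} {q : ℕ × ℕ} : e.deqPair = some q ↔ e = .deq q.1 q.2 := by
  cases e <;> simp [Ev.deqPair, Prod.ext_iff]

/-- Items are pairs of a position and a value. If the dequeued items form a prefix of the
enqueued ones, every item is dequeued after it is enqueued, and the empty dequeues occur when
every enqueued item has been dequeued, then the events form an execution of the queue. -/
theorem seqQueueExec_of_events (l : List Ev) (q rest : List (ℕ × ℕ))
    (hnd : (q ++ l.filterMap Ev.enqPair).Nodup)
    (hpre : q ++ l.filterMap Ev.enqPair = l.filterMap Ev.deqPair ++ rest)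
    (hdeq : ∀ p s t x, l = p ++ .deq t x :: s → (t, x) ∈ q ∨ Ev.enq t x ∈ p)
    (hemp : ∀ p s, l = p ++ .emp :: s → ∀ t x, (t, x) ∈ q ∨ Ev.enq t x ∈ p → Ev.deq t x ∈ p) :
    ∃ qf, SeqQueueExec (q.map Prod.snd) (l.map fun e => (e.op, e.res)) qf := by
  induction l generalizing q with
  | nil => exact ⟨_, .nil _⟩
  | cons e l ih =>
    cases e with
    | enq t x =>
      have h1 : (Ev.enq t x :: l).filterMap Ev.enqPair = (t, x) :: l.filterMap Ev.enqPair := rfl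
      have h2 : (Ev.enq t x :: l).filterMap Ev.deqPair = l.filterMap Ev.deqPair := rfl
      rw [h1] at hnd hpre
      rw [h2] at hpre
      obtain ⟨qf, hqf⟩ := ih (q ++ [(t, x)]) (by simpa using hnd) (by simpa using hpre)
        (by
          intro p s t' x' hl
          have := hdeq (.enq t x :: p) s t' x' (by rw [hl]; rfl)
          simp only [List.mem_cons, Ev.enq.injEq, List.mem_append, Prod.mk.injEq,
            List.not_mem_nil, or_false] at this ⊢
          tauto)
        (by
          intro p s hl t' x' hm
          have := hemp (.enq t x :: p) s (by rw [hl]; rfl) t' x'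
          simp only [List.mem_cons, Ev.enq.injEq, List.mem_append, Prod.mk.injEq,
            List.not_mem_nil, or_false, reduceCtorEq, false_or] at this hm ⊢
          tauto)
      exact ⟨qf, .cons (Or.inl ⟨x, rfl, by simp⟩) hqf⟩
    | deq t x =>
      have hmem : (t, x) ∈ q := by simpa using hdeq [] l t x rfl
      cases q with
      | nil => simp at hmem
      | cons y q =>
        have h1 : (Ev.deq t x :: l).filterMap Ev.enqPair = l.filterMap Ev.enqPair := rfl
        have h2 : (Ev.deq t x :: l).filterMap Ev.deqPair = (t, x) :: l.filterMap Ev.deqPair := rfl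
        rw [h1] at hnd hpre
        rw [h2, List.cons_append, List.cons_append, List.cons.injEq] at hpre
        obtain ⟨rfl, hpre'⟩ := hpre
        have hnd' := hnd
        rw [List.cons_append, List.nodup_cons] at hnd'
        obtain ⟨qf, hqf⟩ := ih q hnd'.2 hpre'
          (by
            intro p s t' x' hl
            have h1 := hdeq (.deq t x :: p) s t' x' (by rw [hl]; rfl)
            have h2 : (t', x') ≠ (t, x) := by
              intro he
              apply hnd'.1
              rw [hpre', ← he, hl]
              simp [Ev.deqPair]
            simpa [h2] using h1)
          (by
            intro p s hl t' x' hm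
            have h1 := hemp (.deq t x :: p) s (by rw [hl]; rfl) t' x'
              (by simp only [List.mem_cons, reduceCtorEq, false_or]; tauto)
            have h2 : (t', x') ≠ (t, x) := by
              intro he
              apply hnd'.1
              rw [← he, hl]
              simp only [List.mem_append, List.mem_filterMap, Ev.enqPair_eq_some]
              rcases hm with hm | hm
              · exact Or.inl hm
              · exact Or.inr ⟨_, Or.inl hm, rfl⟩
            simp only [List.mem_cons, Ev.deq.injEq] at h1
            simp only [ne_eq, Prod.mk.injEq] at h2
            tauto)
        exact ⟨qf, .cons (Or.inr (Or.inl ⟨x, rfl, rfl⟩)) hqf⟩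
    | emp =>
      have hq : q = [] := by
        refine List.eq_nil_iff_forall_not_mem.2 fun y hy => ?_
        simpa using hemp [] l rfl y.1 y.2 (Or.inl hy)
      subst hq
      obtain ⟨qf, hqf⟩ := ih [] hnd hpre
        (by
          intro p s t' x' hl
          simpa using hdeq (.emp :: p) s t' x' (by rw [hl]; rfl))
        (by
          intro p s hl t' x' hm
          simpa using hemp (.emp :: p) s (by rw [hl]; rfl) t' x' (by simpa using hm))
      exact ⟨qf, .cons (Or.inr (Or.inr ⟨rfl, rfl, rfl⟩)) hqf⟩

theorem exists_sorted_list {κ : Type*} [LinearOrder κ] (s : Finset ℕ) (key : ℕ → κ) :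
    ∃ l : List ℕ, l.Nodup ∧ (∀ k, k ∈ l ↔ k ∈ s) ∧ l.Pairwise fun a b => key a ≤ key b := by
  classical
  refine ⟨s.toList.mergeSort (fun a b => decide (key a ≤ key b)), ?_, ?_, ?_⟩
  · exact (List.mergeSort_perm _ _).nodup_iff.2 s.nodup_toList
  · intro k; rw [(List.mergeSort_perm _ _).mem_iff, Finset.mem_toList]
  · have := List.pairwise_mergeSort (le := fun a b => decide (key a ≤ key b))
      (fun a b c h1 h2 => by simp only [decide_eq_true_eq] at *; exact h1.trans h2)
      (fun a b => by simpa using le_total _ _) s.toList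
    simpa using this

/-- Events at time steps, with the invocation times of the corresponding operations. -/
structure QueueTrace (E : ℕ → Option Ev) (inv : ℕ → ℕ) : Prop where
  inv_lt : ∀ {k e}, E k = some e → inv k < k
  enq_unique : ∀ {k k' t x x'}, E k = some (.enq t x) → E k' = some (.enq t x') → k = k'
  deq_unique : ∀ {k k' t x x'}, E k = some (.deq t x) → E k' = some (.deq t x') → k = k'
  exists_enq : ∀ {k t x}, E k = some (.deq t x) → ∃ d < k, E d = some (.enq t x)
  pos_lt : ∀ {k k' t t' x x'}, E k = some (.enq t x) → E k' = some (.enq t' x') →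
    k' < inv k → t' < t
  deq_lt : ∀ {k k' d t t' x x' y}, E k = some (.enq t x) → E k' = some (.enq t' x') →
    k' < inv k → E d = some (.deq t y) → ∃ d' < d, ∃ z, E d' = some (.deq t' z)
  exists_read : ∀ {k}, E k = some .emp → ∃ R, inv k < R ∧ R < k ∧ E R = none ∧
    ∀ k' < R, ∀ t x, E k' = some (.enq t x) → ∃ d < R, ∃ y, E d = some (.deq t y)

theorem QueueTrace.exists_linearization {E : ℕ → Option Ev} {inv : ℕ → ℕ}
    (h : QueueTrace E inv) (N : ℕ) :
    ∃ ks : List ℕ, ks.Nodup ∧ (∀ k, k ∈ ks ↔ k < N ∧ (E k).isSome) ∧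
      ks.Pairwise (fun k k' => inv k ≤ k') ∧
      ∃ qf, SeqQueueExec []
        (ks.map fun k => (((E k).getD .emp).op, ((E k).getD .emp).res)) qf := by
  classical
  -- removal times, with the untaken positions at the end, in increasing order
  have hS : ∀ t, ∃ s, (∀ d < N, ∀ x, E d = some (.deq t x) → s = d) ∧
      ((¬ ∃ d < N, ∃ x, E d = some (.deq t x)) → s = N + t) := by
    intro t
    by_cases ht : ∃ d < N, ∃ x, E d = some (.deq t x)
    · obtain ⟨d, hd, x, hx⟩ := ht
      exact ⟨d, fun d' _ x' hx' => h.deq_unique hx hx', fun hn => (hn ⟨d, hd, x, hx⟩).elim⟩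
    · exact ⟨N + t, fun d hd x hx => (ht ⟨d, hd, x, hx⟩).elim, fun _ => rfl⟩
  choose S hS1 hS2 using hS
  have hS3 : ∀ t, S t < N → ∃ d < N, ∃ x, E d = some (.deq t x) ∧ S t = d := by
    intro t ht
    by_contra hn
    have := hS2 t (fun ⟨d, hd, x, hx⟩ => hn ⟨d, hd, x, hx, hS1 t d hd x hx⟩)
    omega
  have hSinj : ∀ t t', S t = S t' → t = t' := by
    intro t t' htt
    by_cases h1 : S t < N
    · obtain ⟨d, -, x, hx, hd⟩ := hS3 t h1
      obtain ⟨d', -, x', hx', hd'⟩ := hS3 t' (htt ▸ h1)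
      obtain rfl : d = d' := by omega
      rw [hx] at hx'
      simp only [Option.some.injEq, Ev.deq.injEq] at hx'
      exact hx'.1
    · have h2 := hS2 t (fun ⟨d, hd, x, hx⟩ => h1 (by rw [hS1 t d hd x hx]; exact hd))
      have h3 := hS2 t' (fun ⟨d, hd, x, hx⟩ => h1 (by rw [htt, hS1 t' d hd x hx]; exact hd))
      omega
  -- linearization times of the enqueues
  have he : ∀ t, ∃ m, (∃ k < N, ∃ x, E k = some (.enq t x)) →
      (m < N ∧ ∃ t' x', E m = some (.enq t' x') ∧ S t ≤ S t') ∧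
      ∀ m' < N, ∀ t' x', E m' = some (.enq t' x') → S t ≤ S t' → m ≤ m' := by
    intro t
    by_cases ht : ∃ k < N, ∃ x, E k = some (.enq t x)
    · have hex : ∃ m, m < N ∧ ∃ t' x', E m = some (.enq t' x') ∧ S t ≤ S t' := by
        obtain ⟨k, hk, x, hx⟩ := ht
        exact ⟨k, hk, t, x, hx, le_rfl⟩
      exact ⟨Nat.find hex, fun _ => ⟨Nat.find_spec hex,
        fun m' hm' t' x' hx' hSt => Nat.find_min' hex ⟨hm', t', x', hx', hSt⟩⟩⟩
    · exact ⟨0, fun h' => (ht h').elim⟩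
  choose e he using he
  have he_le : ∀ k < N, ∀ t x, E k = some (.enq t x) → e t ≤ k := fun k hk t x hx =>
    (he t ⟨k, hk, x, hx⟩).2 k hk t x hx le_rfl
  have inv_le_e : ∀ k < N, ∀ t x, E k = some (.enq t x) → inv k ≤ e t := by
    intro k hk t x hx
    obtain ⟨⟨hm, t', x', hx', hSt⟩, -⟩ := he t ⟨k, hk, x, hx⟩
    by_contra! hlt
    have h1 := h.pos_lt hx hx' hlt
    by_cases htk : S t < N
    · obtain ⟨d, hd, y, hy, hSd⟩ := hS3 t htk
      obtain ⟨d', hd', z, hz⟩ := h.deq_lt hx hx' hlt hy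
      have := hS1 t' d' (by omega) z hz
      omega
    · have h2 := hS2 t (fun ⟨d, hd, x, hx⟩ => htk (by rw [hS1 t d hd x hx]; exact hd))
      have h3 := hS2 t' (fun ⟨d, hd, x, hx⟩ => by have := hS1 t' d hd x hx; omega)
      omega
  have he_mono : ∀ k < N, ∀ k' < N, ∀ t t' x x', E k = some (.enq t x) →
      E k' = some (.enq t' x') → S t ≤ S t' → e t ≤ e t' := by
    intro k hk k' hk' t t' x x' hx hx' hSt
    obtain ⟨⟨hm, t'', x'', hx'', hSt'⟩, -⟩ := he t' ⟨k', hk', x', hx'⟩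
    exact (he t ⟨k, hk, x, hx⟩).2 _ hm _ _ hx'' (hSt.trans hSt')
  have hR : ∀ k, ∃ R, E k = some .emp → inv k < R ∧ R < k ∧ E R = none ∧
      ∀ k' < R, ∀ t x, E k' = some (.enq t x) → ∃ d < R, ∃ y, E d = some (.deq t y) := by
    intro k
    by_cases hk : E k = some .emp
    · obtain ⟨R, hR⟩ := h.exists_read hk
      exact ⟨R, fun _ => hR⟩
    · exact ⟨0, fun hk' => (hk hk').elim⟩
  choose R hR using hR
  let key : ℕ → ℕ ×ₗ ℕ := fun k => match E k with
    | some (.enq t _) => toLex (e t, S t)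
    | some (.deq _ _) => toLex (k, 0)
    | _ => toLex (R k, 0)
  have key_enq : ∀ {k t x}, E k = some (.enq t x) → key k = toLex (e t, S t) := by
    intro k t x hx; simp only [key, hx]
  have key_deq : ∀ {k t x}, E k = some (.deq t x) → key k = toLex (k, 0) := by
    intro k t x hx; simp only [key, hx]
  have key_emp : ∀ {k}, E k = some .emp → key k = toLex (R k, 0) := by
    intro k hx; simp only [key, hx]
  have key_bound : ∀ {k v}, k < N → E k = some v →
      inv k ≤ (ofLex (key k)).1 ∧ (ofLex (key k)).1 ≤ k := by
    intro k v hk hv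
    cases v with
    | enq t x => rw [key_enq hv]; exact ⟨inv_le_e k hk t x hv, he_le k hk t x hv⟩
    | deq t x => rw [key_deq hv]; exact ⟨(h.inv_lt hv).le, le_rfl⟩
    | emp => rw [key_emp hv]; exact ⟨(hR k hv).1.le, (hR k hv).2.1.le⟩
  obtain ⟨ks, hnd, hmem, hsort⟩ :=
    exists_sorted_list ((Finset.range N).filter fun k => (E k).isSome) key
  simp only [Finset.mem_filter, Finset.mem_range] at hmem
  have hev : ∀ k ∈ ks, k < N ∧ E k = some ((E k).getD .emp) := by
    intro k hk
    obtain ⟨h1, h2⟩ := (hmem k).1 hk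
    obtain ⟨v, hv⟩ := Option.isSome_iff_exists.1 h2
    exact ⟨h1, by rw [hv]; rfl⟩
  have hmem' : ∀ {k v}, k < N → E k = some v → k ∈ ks := fun hk hv =>
    (hmem _).2 ⟨hk, by rw [hv]; rfl⟩
  refine ⟨ks, hnd, hmem, ?_, ?_⟩
  · refine hsort.imp_of_mem fun {k k'} hk hk' hle => ?_
    obtain ⟨h1, h2⟩ := hev k hk
    obtain ⟨h3, h4⟩ := hev k' hk'
    have h5 := (key_bound h1 h2).1
    have h6 := (key_bound h3 h4).2
    have h7 : (ofLex (key k)).1 ≤ (ofLex (key k')).1 := Prod.Lex.monotone_fst_ofLex hle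
    omega
  set ev : ℕ → Ev := fun k => (E k).getD .emp with hevdef
  set l := ks.map ev with hl
  have hl_mem : ∀ v, v ∈ l ↔ ∃ k < N, E k = some v := by
    intro v
    rw [hl, List.mem_map]
    constructor
    · rintro ⟨k, hk, rfl⟩; exact ⟨k, hev k hk⟩
    · rintro ⟨k, hk, hv⟩; exact ⟨k, hmem' hk hv, by simp [hevdef, hv]⟩
  have enq_mem : ∀ q, q ∈ l.filterMap Ev.enqPair ↔ ∃ k < N, E k = some (.enq q.1 q.2) := by
    intro q
    simp only [List.mem_filterMap, Ev.enqPair_eq_some, exists_eq_right, hl_mem]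
  have deq_mem : ∀ q, q ∈ l.filterMap Ev.deqPair ↔ ∃ k < N, E k = some (.deq q.1 q.2) := by
    intro q
    simp only [List.mem_filterMap, Ev.deqPair_eq_some, exists_eq_right, hl_mem]
  have hsort' := hsort.and hnd
  have enq_sorted : (l.filterMap Ev.enqPair).Pairwise fun q q' => S q.1 < S q'.1 := by
    rw [List.pairwise_filterMap, hl, List.pairwise_map]
    refine hsort'.imp_of_mem fun {k k'} hk hk' hle q hq q' hq' => ?_
    rw [Ev.enqPair_eq_some] at hq hq'
    obtain ⟨h1, h2⟩ := hev k hk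
    obtain ⟨h3, h4⟩ := hev k' hk'
    replace h2 : E k = some (.enq q.1 q.2) := h2.trans (congrArg some hq)
    replace h4 : E k' = some (.enq q'.1 q'.2) := h4.trans (congrArg some hq')
    have hle1 := hle.1
    rw [key_enq h2, key_enq h4, Prod.Lex.toLex_le_toLex] at hle1
    by_contra! hlt
    have hm := he_mono k' h3 k h1 _ _ _ _ h4 h2 hlt
    have hSS : S q.1 = S q'.1 := by
      simp only at hle1
      omega
    have := hSinj _ _ hSS
    rw [this] at h2
    exact hle.2 (h.enq_unique h2 h4)
  have deq_sorted : (l.filterMap Ev.deqPair).Pairwise fun q q' => S q.1 < S q'.1 := by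
    rw [List.pairwise_filterMap, hl, List.pairwise_map]
    refine hsort'.imp_of_mem fun {k k'} hk hk' hle q hq q' hq' => ?_
    rw [Ev.deqPair_eq_some] at hq hq'
    obtain ⟨h1, h2⟩ := hev k hk
    obtain ⟨h3, h4⟩ := hev k' hk'
    replace h2 : E k = some (.deq q.1 q.2) := h2.trans (congrArg some hq)
    replace h4 : E k' = some (.deq q'.1 q'.2) := h4.trans (congrArg some hq')
    have hle1 := hle.1
    have hle2 := hle.2
    rw [key_deq h2, key_deq h4, Prod.Lex.toLex_le_toLex] at hle1
    rw [hS1 _ _ h1 _ h2, hS1 _ _ h3 _ h4]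
    simp only at hle1
    omega
  have nodup_of_sorted : ∀ {L : List (ℕ × ℕ)}, (L.Pairwise fun q q' => S q.1 < S q'.1) →
      L.Nodup := fun hL => hL.imp fun hlt heq => by rw [heq] at hlt; exact lt_irrefl _ hlt
  set rest := (l.filterMap Ev.enqPair).filter fun q => decide (N ≤ S q.1) with hrest
  have rest_sorted : rest.Pairwise fun q q' => S q.1 < S q'.1 := enq_sorted.filter _
  have hcat_sorted :
      (l.filterMap Ev.deqPair ++ rest).Pairwise fun q q' => S q.1 < S q'.1 := by
    rw [List.pairwise_append]
    refine ⟨deq_sorted, rest_sorted, fun q hq q' hq' => ?_⟩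
    obtain ⟨k, hk, hv⟩ := (deq_mem q).1 hq
    rw [hS1 _ _ hk _ hv]
    rw [hrest, List.mem_filter, decide_eq_true_eq] at hq'
    omega
  have hperm : (l.filterMap Ev.enqPair).Perm (l.filterMap Ev.deqPair ++ rest) := by
    rw [List.perm_ext_iff_of_nodup (nodup_of_sorted enq_sorted) (nodup_of_sorted hcat_sorted)]
    intro q
    rw [List.mem_append, hrest, List.mem_filter, decide_eq_true_eq, enq_mem, deq_mem]
    constructor
    · rintro ⟨k, hk, hv⟩
      by_cases hq : S q.1 < N
      · obtain ⟨d, hd, y, hy, -⟩ := hS3 _ hq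
        obtain ⟨k', hk', hv'⟩ := h.exists_enq hy
        obtain rfl := h.enq_unique hv hv'
        rw [hv] at hv'
        simp only [Option.some.injEq, Ev.enq.injEq, true_and] at hv'
        exact Or.inl ⟨d, hd, hv' ▸ hy⟩
      · exact Or.inr ⟨⟨k, hk, hv⟩, by omega⟩
    · rintro (⟨k, hk, hv⟩ | ⟨hv, -⟩)
      · obtain ⟨k', hk', hv'⟩ := h.exists_enq hv
        exact ⟨k', by omega, hv'⟩
      · exact hv
  have hpre : l.filterMap Ev.enqPair = l.filterMap Ev.deqPair ++ rest :=
    hperm.eq_of_pairwise (fun a b _ _ h1 h2 => (lt_asymm h1 h2).elim) enq_sorted hcat_sorted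
  have hsplit : ∀ p s v, l = p ++ v :: s → ∃ k < N, E k = some v ∧
      (∀ k' < N, ∀ v', E k' = some v' → k' ≠ k → ¬ key k ≤ key k' → v' ∈ p) ∧
      ∀ v' ∈ p, ∃ k' < N, E k' = some v' ∧ key k' ≤ key k := by
    intro p s v hp
    rw [hl, List.map_eq_append_iff] at hp
    obtain ⟨k1, k2, hks, rfl, h2⟩ := hp
    rw [List.map_eq_cons_iff] at h2
    obtain ⟨k, k3, rfl, rfl, rfl⟩ := h2
    have hk := hev k (by rw [hks]; simp)
    rw [hks, List.pairwise_append, List.pairwise_cons] at hsort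
    refine ⟨k, hk.1, hk.2, ?_, ?_⟩
    · intro k' hk' v' hv' hne hkey
      have h3 := hmem' hk' hv'
      rw [hks, List.mem_append, List.mem_cons] at h3
      rcases h3 with h3 | h3 | h3
      · exact List.mem_map.2 ⟨k', h3, by simp [hevdef, hv']⟩
      · exact (hne h3).elim
      · exact (hkey (hsort.2.1.1 k' h3)).elim
    · intro v' hv'
      obtain ⟨k', hk', rfl⟩ := List.mem_map.1 hv'
      have h3 := hev k' (by rw [hks]; simp [hk'])
      exact ⟨k', h3.1, h3.2, hsort.2.2 k' hk' k (by simp)⟩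
  have hfinal := seqQueueExec_of_events l [] rest
    (by simpa using nodup_of_sorted enq_sorted) (by simpa using hpre)
    (by
      intro p s t x hp
      obtain ⟨d, hd, hv, h1, -⟩ := hsplit p s _ hp
      obtain ⟨k, hk, hv'⟩ := h.exists_enq hv
      refine Or.inr (h1 k (by omega) _ hv' (by omega) ?_)
      rw [key_deq hv, key_enq hv', Prod.Lex.toLex_le_toLex]
      have := he_le k (by omega) _ _ hv'
      simp only
      omega)
    (by
      intro p s hp t x hm
      simp only [List.not_mem_nil, false_or] at hm
      obtain ⟨d, hd, hv, h1, h2⟩ := hsplit p s _ hp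
      obtain ⟨k, hk, hvk, hkey⟩ := h2 _ hm
      obtain ⟨-, hRd, hRn, hRt⟩ := hR d hv
      rw [key_enq hvk, key_emp hv, Prod.Lex.toLex_le_toLex] at hkey
      obtain ⟨⟨hm, t', x', hx', hSt⟩, -⟩ := he t ⟨k, hk, x, hvk⟩
      have hne : e t ≠ R d := by
        intro heq
        rw [heq, hRn] at hx'
        simp at hx'
      simp only at hkey
      obtain ⟨d', hd', y, hy⟩ := hRt (e t) (by omega) _ _ hx'
      have hSd := hS1 t' d' (by omega) y hy
      obtain ⟨d2, hd2, y2, hy2, hSd2⟩ := hS3 t (by omega)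
      obtain ⟨k', hk', hvk'⟩ := h.exists_enq hy2
      obtain rfl := h.enq_unique hvk hvk'
      rw [hvk] at hvk'
      simp only [Option.some.injEq, Ev.enq.injEq, true_and] at hvk'
      refine h1 d2 hd2 _ (hvk' ▸ hy2) (by omega) ?_
      rw [key_deq hy2, key_emp hv, Prod.Lex.toLex_le_toLex]
      simp only
      omega)
  simpa [hl, List.map_map, Function.comp_def] using hfinal

end Sequential

section History

variable {n : ℕ} {c : ℕ → Config n} {sched : ℕ → Fin n}

theorem exists_queueTrace (h : Run c sched) : ∃ inv : ℕ → ℕ,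
    QueueTrace (fun k => evt (c k) (sched k)) inv ∧
    ∀ k e, evt (c k) (sched k) = some e → Det c sched k e.op e.res (inv k) := by
  have hinv : ∀ k, ∃ a, ∀ e, evt (c k) (sched k) = some e →
      a < k ∧ (c k).pend (sched k) = some (e.op, a) := by
    intro k
    cases he : evt (c k) (sched k) with
    | none => exact ⟨0, by simp⟩
    | some e =>
      obtain ⟨a, ha⟩ := exists_det_of_evt h he
      refine ⟨a, ?_⟩
      rintro e' ⟨⟩
      exact ha
  choose inv hinv using hinv
  refine ⟨inv, ?_, fun k e he => ⟨e, he, rfl, rfl, (hinv k e he).2⟩⟩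
  exact {
    inv_lt := fun he => (hinv _ _ he).1
    enq_unique := fun he he' => enq_unique h he he'
    deq_unique := fun he he' => deq_unique h he he'
    exists_enq := fun he => exists_enq_of_deq h he
    pos_lt := fun he he' hk =>
      (lt_tail_of_enq_lt h he' hk).trans_le (tail_le_of_enq h he (hinv _ _ he).2)
    deq_lt := fun he he' hk hd => exists_deq_lt_of_lt_inv h he (hinv _ _ he).2 he' hk hd
    exists_read := fun he => exists_read_of_emp h he (hinv _ _ he).2 }

theorem step_log {s s' : Config n} {i : Fin n} (h : Step s i s') :
    (s'.log = s.log ∧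
      ((∀ j, s'.pend j = s.pend j) ∨
        ∃ op, s'.pend = Function.update s.pend i (some (op, s.time)))) ∨
    ∃ res op a, s.proc i = .done res ∧ s.pend i = some (op, a) ∧
      s'.log = s.log ++ [⟨i, op, res, a, s.time⟩] ∧ s'.pend = Function.update s.pend i none := by
  cases h
  case respond res op t0 hp hq => exact Or.inr ⟨res, op, t0, hp, hq, rfl, rfl⟩
  case invEnq x _ _ => exact Or.inl ⟨rfl, Or.inr ⟨_, rfl⟩⟩
  case invDeq => exact Or.inl ⟨rfl, Or.inr ⟨_, rfl⟩⟩
  all_goals exact Or.inl ⟨rfl, Or.inl fun _ => rfl⟩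

theorem run_log_det (h : Run c sched) (k : ℕ) :
    ∀ e ∈ (c k).log, e.retT < k ∧ ∃ d < e.retT, Det c sched d e.op e.res e.invT := by
  induction k with
  | zero => rw [h.1]; simp [initConfig]
  | succ k ih =>
    intro e he
    have hpi := (run_inv h k).pinv (sched k)
    rcases step_log (h.2 k) with ⟨hl, -⟩ | ⟨res, op, a, hp, hq, hl, -⟩
    · obtain ⟨h1, h2⟩ := ih e (hl ▸ he)
      exact ⟨by omega, h2⟩
    · rw [hl, List.mem_append, List.mem_singleton] at he
      rcases he with he | rfl
      · obtain ⟨h1, h2⟩ := ih e he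
        exact ⟨by omega, h2⟩
      · rw [hp] at hpi
        obtain ⟨op', a', d, hq', hd, hdet⟩ := hpi
        rw [hq, Option.some.injEq, Prod.mk.injEq] at hq'
        obtain ⟨rfl, rfl⟩ := hq'
        have ht := run_time h k
        exact ⟨by simp [ht], d, by simpa [ht] using hd, hdet⟩

theorem run_log_nodup (h : Run c sched) (k : ℕ) :
    ((c k).log.map LogEntry.invT).Nodup ∧ (∀ e ∈ (c k).log, e.invT < k) ∧
    ∀ i op a, (c k).pend i = some (op, a) → ∀ e ∈ (c k).log, e.invT ≠ a := by
  induction k with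
  | zero => rw [h.1]; simp [initConfig]
  | succ k ih =>
    obtain ⟨ih1, ih2, ih3⟩ := ih
    have ht := run_time h k
    rcases step_log (h.2 k) with ⟨hl, hp⟩ | ⟨res, op, a, hp, hq, hl, hq'⟩
    · rw [hl]
      refine ⟨ih1, fun e he => (ih2 e he).trans (Nat.lt_succ_self k), ?_⟩
      intro i op a hi e he
      rcases hp with hp | ⟨op', hp⟩
      · exact ih3 i op a (hp i ▸ hi) e he
      · rw [hp, Function.update_apply] at hi
        split_ifs at hi
        · cases hi
          rw [ht]
          exact (ih2 e he).ne
        · exact ih3 i op a hi e he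
    · rw [hl, hq']
      refine ⟨?_, ?_, ?_⟩
      · rw [List.map_append, List.nodup_append]
        refine ⟨ih1, List.nodup_singleton _, ?_⟩
        simp only [List.mem_map, List.map_cons, List.map_nil, List.mem_singleton]
        rintro _ ⟨e, he, rfl⟩ _ rfl
        exact ih3 _ _ _ hq e he
      · intro e he
        rw [List.mem_append, List.mem_singleton] at he
        rcases he with he | rfl
        · exact (ih2 e he).trans (Nat.lt_succ_self k)
        · exact (run_pend h k _ _ _ hq).1.trans (Nat.lt_succ_self k)
      · intro i op' a' hi e he
        rw [Function.update_apply] at hi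
        split_ifs at hi with hik
        rw [List.mem_append, List.mem_singleton] at he
        rcases he with he | rfl
        · exact ih3 _ _ _ hi e he
        · rintro rfl
          exact hik ((run_pend h k _ _ _ hi).2.symm.trans (run_pend h k _ _ _ hq).2)

theorem Det.invT_lt (h : Run c sched) {d a : ℕ} {op : QueueOp} {res : QueueRes}
    (hd : Det c sched d op res a) : a < d ∧ sched a = sched d := by
  obtain ⟨e, -, -, -, hp⟩ := hd
  exact run_pend h d _ _ _ hp

theorem Det.logged_or_pending (h : Run c sched) {d a k : ℕ} {op : QueueOp} {res : QueueRes}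
    (hd : Det c sched d op res a) (hk : d < k) :
    (∃ e ∈ (c k).log, e.op = op ∧ e.res = res ∧ e.invT = a ∧ d < e.retT) ∨
    ((c k).pend (sched d) = some (op, a) ∧ (c k).proc (sched d) = .done res) := by
  induction k, hk using Nat.le_induction with
  | base =>
    obtain ⟨e, he, rfl, rfl, hp⟩ := hd
    obtain ⟨h1, h2, -⟩ := step_of_evt (h.2 d) he
    exact Or.inr ⟨h2 ▸ hp, h1⟩
  | succ k hk ih =>
    have hs := h.2 k
    have ht := run_time h k
    rcases ih with ⟨e, he, h1⟩ | ⟨h1, h2⟩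
    · refine Or.inl ⟨e, ?_, h1⟩
      rcases step_log hs with ⟨hl, -⟩ | ⟨_, _, _, -, -, hl, -⟩
      · rwa [hl]
      · rw [hl]; exact List.mem_append_left _ he
    · by_cases hik : sched d = sched k
      · rw [hik] at h1 h2 ⊢
        left
        generalize c (k + 1) = c' at *
        cases hs <;> simp_all
      · right
        generalize c (k + 1) = c' at *
        cases hs <;> simp_all

theorem Det.unique (h : Run c sched) {d d' a : ℕ} {op op' : QueueOp} {res res' : QueueRes}
    (hd : Det c sched d op res a) (hd' : Det c sched d' op' res' a) : d = d' := by
  have key : ∀ {d d' op op' res res'}, Det c sched d op res a → Det c sched d' op' res' a →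
      ¬ d < d' := by
    intro d d' op op' res res' hd hd' hlt
    have hs : sched d = sched d' := (hd.invT_lt h).2.symm.trans (hd'.invT_lt h).2
    obtain ⟨e', he', -, -, hp'⟩ := hd'
    rcases hd.logged_or_pending h hlt with ⟨e, he, -, -, h1, -⟩ | ⟨-, h2⟩
    · exact (run_log_nodup h d').2.2 _ _ _ hp' e he h1
    · rw [hs] at h2
      simp [evt, h2] at he'
  rcases lt_trichotomy d d' with hlt | heq | hlt
  · exact (key hd hd' hlt).elim
  · exact heq
  · exact (key hd' hd hlt).elim

theorem pendingList_nodup (h : Run c sched) (k : ℕ) :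
    ((pendingList (c k)).map Prod.snd).Nodup := by
  rw [List.nodup_iff_pairwise_ne, List.pairwise_map]
  unfold pendingList
  rw [List.pairwise_filterMap]
  refine List.Pairwise.imp ?_ (List.nodup_finRange n)
  rintro i j hij ⟨op, a⟩ hi ⟨op', a'⟩ hj rfl
  exact hij ((run_pend h k _ _ _ hi).2.symm.trans (run_pend h k _ _ _ hj).2)

theorem historyAt_inv (s : Config n) (j : Fin (historyAt s).m) :
    (historyAt s).inv j =
      (s.log.map LogEntry.invT ++ (pendingList s).map Prod.snd)[(j : ℕ)]'(by
        have := j.2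
        simpa [historyAt] using this) := by
  have hj : (j : ℕ) < s.log.length + (pendingList s).length := j.2
  simp only [historyAt]
  split_ifs with hlt
  · simp [hlt]
  · simp only [List.getElem_append, List.length_map, hlt, dite_false, List.getElem_map]
    rw [List.getD_eq_getElem _ _ (by omega)]

theorem historyAt_inv_injective (h : Run c sched) (k : ℕ) :
    Function.Injective (historyAt (c k)).inv := by
  have hnd : ((c k).log.map LogEntry.invT ++ (pendingList (c k)).map Prod.snd).Nodup := by
    rw [List.nodup_append]
    refine ⟨(run_log_nodup h k).1, pendingList_nodup h k, ?_⟩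
    intro a ha b hb
    obtain ⟨e, he, rfl⟩ := List.mem_map.1 ha
    obtain ⟨⟨op, b⟩, hb', rfl⟩ := List.mem_map.1 hb
    obtain ⟨i, -, hi⟩ := List.mem_filterMap.1 hb'
    exact (run_log_nodup h k).2.2 _ _ _ hi e he
  intro i j hij
  rw [historyAt_inv, historyAt_inv, hnd.getElem_inj_iff] at hij
  exact Fin.ext hij

theorem exists_index_of_mem_log {s : Config n} {e : LogEntry n} (he : e ∈ s.log) :
    ∃ j : Fin (historyAt s).m, (historyAt s).op j = e.op ∧ (historyAt s).inv j = e.invT ∧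
      (historyAt s).ret j = some e.retT ∧ (historyAt s).out j = some e.res := by
  obtain ⟨i, hi, rfl⟩ := List.getElem_of_mem he
  exact ⟨⟨i, by simp only [historyAt]; omega⟩, by simp [historyAt, hi]⟩

theorem exists_index_of_pend {s : Config n} {i : Fin n} {op : QueueOp} {a : ℕ}
    (hp : s.pend i = some (op, a)) :
    ∃ j : Fin (historyAt s).m, (historyAt s).op j = op ∧ (historyAt s).inv j = a ∧
      (historyAt s).ret j = none ∧ (historyAt s).out j = none := by
  have hm : (op, a) ∈ pendingList s := List.mem_filterMap.2 ⟨i, List.mem_finRange i, hp⟩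
  obtain ⟨i, hi, he⟩ := List.getElem_of_mem hm
  exact ⟨⟨s.log.length + i, by simp only [historyAt]; omega⟩, by simp [historyAt, hi, he]⟩

theorem exists_mem_log_of_out {s : Config n} {j : Fin (historyAt s).m} {r : QueueRes}
    (hj : (historyAt s).out j = some r) :
    ∃ e ∈ s.log, (historyAt s).inv j = e.invT ∧ e.res = r := by
  have hlt : (j : ℕ) < s.log.length := by
    by_contra hlt
    simp [historyAt, hlt] at hj
  refine ⟨s.log[(j : ℕ)], List.getElem_mem _, ?_, ?_⟩
  · simp [historyAt, hlt]
  · simpa [historyAt, hlt] using hj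

/-- The operation of the history that takes effect at step `d`. -/
theorem Det.exists_index (h : Run c sched) {d a N : ℕ} {op : QueueOp} {res : QueueRes}
    (hd : Det c sched d op res a) (hN : d < N) :
    ∃ j : Fin (historyAt (c N)).m, (historyAt (c N)).op j = op ∧ (historyAt (c N)).inv j = a ∧
      ∀ t, (historyAt (c N)).ret j = some t → d < t := by
  rcases hd.logged_or_pending h hN with ⟨e, he, rfl, rfl, rfl, hlt⟩ | ⟨hp, -⟩
  · obtain ⟨j, h1, h2, h3, -⟩ := exists_index_of_mem_log he
    refine ⟨j, h1, h2, fun t ht => ?_⟩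
    rw [h3, Option.some.injEq] at ht
    exact ht ▸ hlt
  · obtain ⟨j, h1, h2, h3, -⟩ := exists_index_of_pend hp
    exact ⟨j, h1, h2, fun t ht => by simp [h3] at ht⟩

theorem run_linearizable (h : Run c sched) (N : ℕ) : Linearizable (historyAt (c N)) := by
  classical
  obtain ⟨inv, htr, hdet⟩ := exists_queueTrace h
  obtain ⟨ks, hnd, hmem, hpw, qf, hexec⟩ := htr.exists_linearization N
  have hidx : ∀ d : {d // d ∈ ks}, ∃ j : Fin (historyAt (c N)).m, ∃ res,
      Det c sched d ((historyAt (c N)).op j) res ((historyAt (c N)).inv j) ∧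
      (historyAt (c N)).inv j = inv d ∧
      (∀ t, (historyAt (c N)).ret j = some t → d < t) ∧
      ((evt (c d) (sched d)).getD .emp).op = (historyAt (c N)).op j ∧
      ((evt (c d) (sched d)).getD .emp).res = res := by
    rintro ⟨d, hd⟩
    obtain ⟨hdN, hs⟩ := (hmem d).1 hd
    obtain ⟨e, he⟩ := Option.isSome_iff_exists.1 hs
    obtain ⟨j, h1, h2, h3⟩ := (hdet d e he).exists_index h hdN
    refine ⟨j, e.res, ?_, h2, h3, ?_, ?_⟩
    · rw [h1, h2]; exact hdet d e he
    · simp [he, h1]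
    · simp [he]
  choose idx res hidx using hidx
  have hlout : ∀ j : Fin (historyAt (c N)).m, ∃ r, ∀ d op r',
      Det c sched d op r' ((historyAt (c N)).inv j) → r' = r := by
    intro j
    by_cases hj : ∃ d op r', Det c sched d op r' ((historyAt (c N)).inv j)
    · obtain ⟨d, op, r, hd⟩ := hj
      refine ⟨r, fun d' op' r' hd' => ?_⟩
      obtain rfl := hd.unique h hd'
      obtain ⟨e, he, -, h2, -⟩ := hd
      obtain ⟨e', he', -, h2', -⟩ := hd'
      rw [he, Option.some.injEq] at he'
      rw [← h2, ← h2', he']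
    · exact ⟨.ok, fun d op r' hd => (hj ⟨d, op, r', hd⟩).elim⟩
  choose lout hlout using hlout
  have hinj : Function.Injective idx := by
    intro d d' heq
    have h1 := (hidx d).1
    rw [heq] at h1
    exact Subtype.ext (h1.unique h (hidx d').1)
  refine ⟨{
    seq := ks.attach.map idx
    lout := lout
    nodup := (List.nodup_attach.2 hnd).map hinj
    complete_mem := ?_
    out_agree := ?_
    order := ?_
    valid := ⟨qf, ?_⟩ }⟩
  · intro j hj
    obtain ⟨r, hr⟩ := Option.isSome_iff_exists.1 hj
    obtain ⟨e, he, h1, -⟩ := exists_mem_log_of_out hr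
    obtain ⟨hret, d, hd, hD⟩ := run_log_det h N e he
    have hdk : d ∈ ks := (hmem d).2 ⟨by omega, by
      obtain ⟨ev, hev, -⟩ := hD
      simp [hev]⟩
    refine List.mem_map.2 ⟨⟨d, hdk⟩, List.mem_attach _ _, ?_⟩
    apply historyAt_inv_injective h N
    obtain ⟨e', he', -, -, h2⟩ := (hidx ⟨d, hdk⟩).1
    obtain ⟨e'', he'', -, -, h3⟩ := hD
    rw [h3, Option.some.injEq, Prod.mk.injEq] at h2
    rw [← h2.2, h1]
  · intro j r hr
    obtain ⟨e, he, h1, h2⟩ := exists_mem_log_of_out hr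
    obtain ⟨-, d, -, hD⟩ := run_log_det h N e he
    rw [← h1] at hD
    rw [← h2, ← hlout j d _ _ hD]
  · rintro ⟨k1, hk1⟩ ⟨k2, hk2⟩ ⟨t, ht, hlt⟩
    simp only [List.get_eq_getElem, List.getElem_map, List.getElem_attach] at ht hlt
    simp only [List.length_map, List.length_attach] at hk1 hk2
    by_contra hle
    have h1 := (hidx _).2.2.1 t ht
    rw [(hidx _).2.1] at hlt
    simp only at h1 hlt
    have h2 : inv ks[k2] < ks[k2] := by
      obtain ⟨-, hs⟩ := (hmem ks[k2]).1 (List.getElem_mem _)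
      obtain ⟨e, he⟩ := Option.isSome_iff_exists.1 hs
      exact htr.inv_lt he
    simp only [not_lt] at hle
    rcases Nat.lt_or_eq_of_le hle with hlt' | rfl
    · have := List.pairwise_iff_getElem.1 hpw k2 k1 hk2 hk1 hlt'
      omega
    · omega
  · convert hexec using 1
    rw [List.map_map]
    conv_rhs => rw [← List.attach_map_subtype_val ks, List.map_map]
    refine List.map_congr_left fun d _ => ?_
    obtain ⟨h1, -, -, h2, h3⟩ := hidx d
    simp only [Function.comp_apply]
    rw [h2, h3, hlout _ _ _ _ h1]

end History

/-- The algorithm SeqQueue — which uses only base objects with consensus number two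
(a Fetch&Increment object and Swap objects) — is a non-blocking linearizable
implementation of the sequential queue, with its `Enq` operation wait-free:
(1) a process that keeps being scheduled completes every `Enq` operation it
invokes, (2) in every infinite execution infinitely many invocations are completed,
and (3) every execution (assuming every item is enqueued at most once) is
linearizable w.r.t. the sequential queue. -/
theorem seqQueue_nonBlocking_linearizable_enqWaitFree (n : ℕ) (hn : 1 ≤ n) :
    (∀ (c : ℕ → Config n) (sched : ℕ → Fin n), Run c sched →
      ∀ i : Fin n, (∀ k, ∃ k' ≥ k, sched k' = i) →
        ∀ k x t, (c k).pend i = some (QueueOp.enq x, t) →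
          ∃ k' > k, (c k').pend i = none) ∧
    (∀ (c : ℕ → Config n) (sched : ℕ → Fin n), Run c sched →
      ∀ m : ℕ, ∃ k, m ≤ (c k).log.length) ∧
    (∀ (c : ℕ → Config n) (sched : ℕ → Fin n), Run c sched → ∀ N : ℕ,
      (∀ (i j : Fin (historyAt (c N)).m) (x : ℕ),
          (historyAt (c N)).op i = QueueOp.enq x →
          (historyAt (c N)).op j = QueueOp.enq x → i = j) →
      Linearizable (historyAt (c N))) := by
  exact ⟨fun c sched h i hi k x t hp => enq_waitFree h hi hp,
    fun c sched h m => run_nonBlocking h m,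
    fun c sched h N _ => run_linearizable h N⟩
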